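/- arXiv:cond-mat/0108486 — 16 statements merged into one kernel-verified Lean document; each statement's English description precedes it below -/
import Mathlib

section
/- The matrix Ř(λ) = a(λ)P_s + b(λ)I₉ on ℂ³⊗ℂ³ satisfies the Yang–Baxter equation in braid form: for all λ, μ ∈ ℂ with λ ≠ −ic, μ ≠ −ic and λ+μ ≠ −ic, one has Ř₁₂(λ) Ř₂₃(λ+μ) Ř₁₂(μ) = Ř₂₃(μ) Ř₁₂(λ+μ) Ř₂₃(λ) as linear maps on ℂ³⊗ℂ³⊗ℂ³, where Ř₁₂ = Ř⊗I₃ and Ř₂₃ = I₃⊗Ř. -/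
noncomputable section

namespace Stmt0

/-- The grading `p(1)=0`, `p(2)=p(3)=1` on the indices `{1,2,3}` (here `Fin 3`). -/
def pa (α : Fin 3) : ℕ := if α = 0 then 0 else 1

/-- `a(λ) = λ/(λ+ic)`. -/
def fa (c lam : ℂ) : ℂ := lam / (lam + Complex.I * c)

/-- `b(λ) = ic/(λ+ic)`. -/
def fb (c lam : ℂ) : ℂ := Complex.I * c / (lam + Complex.I * c)

/-- The gl(1|2)-invariant R-matrix in braid form:
`Ř^{αγ}_{βδ}(λ) = a(λ)(−1)^{p(α)p(γ)} δ^α_δ δ^γ_β + b(λ) δ^α_β δ^γ_δ`,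
i.e. `Ř(λ) = a(λ)P_s + b(λ)I₉`.  Rows are indexed by `(α,γ)`, columns by `(β,δ)`. -/
def Rcheck (c lam : ℂ) : Matrix (Fin 3 × Fin 3) (Fin 3 × Fin 3) ℂ :=
  fun x y =>
    fa c lam * (-1 : ℂ) ^ (pa x.1 * pa x.2) *
        (if x.1 = y.2 then 1 else 0) * (if x.2 = y.1 then 1 else 0)
      + fb c lam * (if x.1 = y.1 then 1 else 0) * (if x.2 = y.2 then 1 else 0)

/-- `Ř₁₂(λ) = Ř(λ) ⊗ I₃` acting on ℂ³⊗ℂ³⊗ℂ³. -/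
def R12 (c lam : ℂ) : Matrix (Fin 3 × Fin 3 × Fin 3) (Fin 3 × Fin 3 × Fin 3) ℂ :=
  fun x y => Rcheck c lam (x.1, x.2.1) (y.1, y.2.1) * (if x.2.2 = y.2.2 then 1 else 0)

/-- `Ř₂₃(λ) = I₃ ⊗ Ř(λ)` acting on ℂ³⊗ℂ³⊗ℂ³. -/
def R23 (c lam : ℂ) : Matrix (Fin 3 × Fin 3 × Fin 3) (Fin 3 × Fin 3 × Fin 3) ℂ :=
  fun x y => (if x.1 = y.1 then 1 else 0) * Rcheck c lam (x.2.1, x.2.2) (y.2.1, y.2.2)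

/-- The monomial matrix with the entry `s x` at `(x, f x)` and zeros elsewhere. -/
def monomialMatrix {n : Type*} [DecidableEq n] (s : n → ℂ) (f : n → n) : Matrix n n ℂ :=
  fun x y => s x * if f x = y then 1 else 0

lemma monomialMatrix_mul {n : Type*} [Fintype n] [DecidableEq n] (s t : n → ℂ) (f g : n → n) :
    monomialMatrix s f * monomialMatrix t g
      = monomialMatrix (fun x => s x * t (f x)) (fun x => g (f x)) := by
  ext x y
  simp only [monomialMatrix, Matrix.mul_apply]
  rw [Finset.sum_eq_single (f x)] <;> simp +contextual [eq_comm]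

/-- The graded permutation of the first two tensor factors. -/
def gradedSwap12 : Matrix (Fin 3 × Fin 3 × Fin 3) (Fin 3 × Fin 3 × Fin 3) ℂ :=
  monomialMatrix (fun x => (-1) ^ (pa x.1 * pa x.2.1)) (fun x => (x.2.1, x.1, x.2.2))

/-- The graded permutation of the last two tensor factors. -/
def gradedSwap23 : Matrix (Fin 3 × Fin 3 × Fin 3) (Fin 3 × Fin 3 × Fin 3) ℂ :=
  monomialMatrix (fun x => (-1) ^ (pa x.2.1 * pa x.2.2)) (fun x => (x.1, x.2.2, x.2.1))

lemma gradedSwap12_mul_self : gradedSwap12 * gradedSwap12 = 1 := by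
  rw [gradedSwap12, monomialMatrix_mul]
  ext x y
  simp [monomialMatrix, Matrix.one_apply, ← pow_add, mul_comm (pa x.2.1)]

lemma gradedSwap23_mul_self : gradedSwap23 * gradedSwap23 = 1 := by
  rw [gradedSwap23, monomialMatrix_mul]
  ext x y
  simp [monomialMatrix, Matrix.one_apply, ← pow_add, mul_comm (pa x.2.2)]

lemma gradedSwap_braid :
    gradedSwap12 * gradedSwap23 * gradedSwap12 = gradedSwap23 * gradedSwap12 * gradedSwap23 := by
  simp only [gradedSwap12, gradedSwap23, monomialMatrix_mul]
  congr 1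
  ext x
  ring

lemma R12_eq (c lam : ℂ) : R12 c lam = fa c lam • gradedSwap12 + fb c lam • 1 := by
  ext ⟨x, y, z⟩ ⟨x', y', z'⟩
  simp only [R12, Rcheck, gradedSwap12, monomialMatrix, Matrix.add_apply, Matrix.smul_apply,
    Matrix.one_apply, smul_eq_mul, Prod.mk.injEq, ite_and]
  split_ifs <;> ring

lemma R23_eq (c lam : ℂ) : R23 c lam = fa c lam • gradedSwap23 + fb c lam • 1 := by
  ext ⟨x, y, z⟩ ⟨x', y', z'⟩
  simp only [R23, Rcheck, gradedSwap23, monomialMatrix, Matrix.add_apply, Matrix.smul_apply,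
    Matrix.one_apply, smul_eq_mul, Prod.mk.injEq, ite_and]
  split_ifs <;> ring

lemma fa_fb_relation (c lam mu : ℂ) (h1 : lam ≠ -(Complex.I * c)) (h2 : mu ≠ -(Complex.I * c))
    (h3 : lam + mu ≠ -(Complex.I * c)) :
    fb c lam * fb c mu * fa c (lam + mu)
      = fa c lam * fb c (lam + mu) * fb c mu + fb c lam * fb c (lam + mu) * fa c mu := by
  have h1' : lam + Complex.I * c ≠ 0 := fun h => h1 (eq_neg_of_add_eq_zero_left h)
  have h2' : mu + Complex.I * c ≠ 0 := fun h => h2 (eq_neg_of_add_eq_zero_left h)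
  have h3' : lam + mu + Complex.I * c ≠ 0 := fun h => h3 (eq_neg_of_add_eq_zero_left h)
  simp only [fa, fb]
  field_simp

/-- Baxterization: two involutions satisfying the braid relation yield a solution of the
Yang–Baxter equation whenever the coefficients satisfy the scalar relation `h`. -/
lemma braid_baxterization {A : Type*} [Ring A] [Algebra ℂ A] {P Q : A} (hP : P * P = 1)
    (hQ : Q * Q = 1) (hPQ : P * Q * P = Q * P * Q) {a b a' b' a'' b'' : ℂ}
    (h : b * b' * a'' = a * b'' * b' + b * b'' * a') :
    (a • P + b • 1) * (a'' • Q + b'' • 1) * (a' • P + b' • 1)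
      = (a' • Q + b' • 1) * (a'' • P + b'' • 1) * (a • Q + b • 1) := by
  simp only [add_mul, mul_add, smul_mul_assoc, mul_smul_comm, mul_one, one_mul, smul_smul,
    hP, hQ, hPQ, smul_add]
  match_scalars <;> first | ring1 | linear_combination h | linear_combination -h

/-- The gl(1|2)-invariant R-matrix `Ř(λ) = a(λ)P_s + b(λ)I₉` satisfies the
Yang–Baxter equation in braid form. -/
theorem gl12_R_yang_baxter (c : ℂ) (hc : c ≠ 0) (lam mu : ℂ)
    (h1 : lam ≠ -(Complex.I * c)) (h2 : mu ≠ -(Complex.I * c))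
    (h3 : lam + mu ≠ -(Complex.I * c)) :
    R12 c lam * R23 c (lam + mu) * R12 c mu
      = R23 c mu * R12 c (lam + mu) * R23 c lam := by
  rw [R12_eq, R12_eq, R12_eq, R23_eq, R23_eq, R23_eq]
  exact braid_baxterization gradedSwap12_mul_self gradedSwap23_mul_self gradedSwap_braid
    (fa_fb_relation c lam mu h1 h2 h3)

end Stmt0
end
end

section
/- The six-vertex matrix ř(λ) = b(λ)I₄ − a(λ)P on ℂ²⊗ℂ² satisfies the Yang–Baxter equation in braid form: for all λ, μ ∈ ℂ with λ ≠ −ic, μ ≠ −ic and λ+μ ≠ −ic, one has ř₁₂(λ) ř₂₃(λ+μ) ř₁₂(μ) = ř₂₃(μ) ř₁₂(λ+μ) ř₂₃(λ) as linear maps on ℂ²⊗ℂ²⊗ℂ², where ř₁₂ = ř⊗I₂ and ř₂₃ = I₂⊗ř. -/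
noncomputable section

namespace Stmt1

/-- `a(λ) = λ/(λ+ic)`. -/
def fa (c lam : ℂ) : ℂ := lam / (lam + Complex.I * c)

/-- `b(λ) = ic/(λ+ic)`. -/
def fb (c lam : ℂ) : ℂ := Complex.I * c / (lam + Complex.I * c)

/-- The six-vertex matrix `ř(λ) = b(λ)I₄ − a(λ)P` on ℂ²⊗ℂ², with entries
`ř^{ik}_{jl}(λ) = b(λ) δ^i_j δ^k_l − a(λ) δ^i_l δ^k_j`.
Rows are indexed by `(i,k)`, columns by `(j,l)`. -/
def rcheck (c lam : ℂ) : Matrix (Fin 2 × Fin 2) (Fin 2 × Fin 2) ℂ :=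
  fun x y =>
    fb c lam * (if x.1 = y.1 then 1 else 0) * (if x.2 = y.2 then 1 else 0)
      - fa c lam * (if x.1 = y.2 then 1 else 0) * (if x.2 = y.1 then 1 else 0)

/-- `ř₁₂(λ) = ř(λ) ⊗ I₂` acting on ℂ²⊗ℂ²⊗ℂ². -/
def r12 (c lam : ℂ) : Matrix (Fin 2 × Fin 2 × Fin 2) (Fin 2 × Fin 2 × Fin 2) ℂ :=
  fun x y => rcheck c lam (x.1, x.2.1) (y.1, y.2.1) * (if x.2.2 = y.2.2 then 1 else 0)

/-- `ř₂₃(λ) = I₂ ⊗ ř(λ)` acting on ℂ²⊗ℂ²⊗ℂ². -/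
def r23 (c lam : ℂ) : Matrix (Fin 2 × Fin 2 × Fin 2) (Fin 2 × Fin 2 × Fin 2) ℂ :=
  fun x y => (if x.1 = y.1 then 1 else 0) * rcheck c lam (x.2.1, x.2.2) (y.2.1, y.2.2)

/-- The transposition of the first two tensor factors, acting on basis indices. -/
def swap12 : Equiv.Perm (Fin 2 × Fin 2 × Fin 2) where
  toFun x := (x.2.1, x.1, x.2.2)
  invFun x := (x.2.1, x.1, x.2.2)
  left_inv _ := rfl
  right_inv _ := rfl

/-- The transposition of the last two tensor factors, acting on basis indices. -/
def swap23 : Equiv.Perm (Fin 2 × Fin 2 × Fin 2) where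
  toFun x := (x.1, x.2.2, x.2.1)
  invFun x := (x.1, x.2.2, x.2.1)
  left_inv _ := rfl
  right_inv _ := rfl

theorem r12_eq (c lam : ℂ) :
    r12 c lam = fb c lam • 1 - fa c lam • swap12.permMatrix ℂ := by
  ext ⟨i, j, k⟩ ⟨i', j', k'⟩
  simp only [r12, rcheck, swap12, Equiv.Perm.permMatrix, PEquiv.toMatrix_apply,
    Equiv.toPEquiv_apply, Equiv.coe_fn_mk, Matrix.sub_apply, Matrix.smul_apply,
    Matrix.one_apply, Prod.mk.injEq, Option.mem_def, Option.some.injEq, smul_eq_mul]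
  grind

theorem r23_eq (c lam : ℂ) :
    r23 c lam = fb c lam • 1 - fa c lam • swap23.permMatrix ℂ := by
  ext ⟨i, j, k⟩ ⟨i', j', k'⟩
  simp only [r23, rcheck, swap23, Equiv.Perm.permMatrix, PEquiv.toMatrix_apply,
    Equiv.toPEquiv_apply, Equiv.coe_fn_mk, Matrix.sub_apply, Matrix.smul_apply,
    Matrix.one_apply, Prod.mk.injEq, Option.mem_def, Option.some.injEq, smul_eq_mul]
  grind

/-- Baxterization: two involutions satisfying the braid relation give a solution of the
Yang–Baxter equation as soon as the scalar coefficients satisfy one cubic relation. -/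
theorem baxterize {R A : Type*} [CommRing R] [Ring A] [Algebra R A] {P Q : A}
    (hP : P * P = 1) (hQ : Q * Q = 1) (hPQ : P * Q * P = Q * P * Q)
    {a₁ b₁ a₂ b₂ a₃ b₃ : R} (h : a₁ * b₂ * b₃ + b₁ * b₂ * a₃ = b₁ * a₂ * b₃) :
    (b₁ • 1 - a₁ • P) * (b₂ • 1 - a₂ • Q) * (b₃ • 1 - a₃ • P)
      = (b₃ • 1 - a₃ • Q) * (b₂ • 1 - a₂ • P) * (b₁ • 1 - a₁ • Q) := by
  simp only [sub_mul, mul_sub, smul_mul_assoc, mul_smul_comm, one_mul, mul_one, hP, hQ, hPQ,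
    smul_sub, smul_smul]
  linear_combination (norm := module) h • (Q - P)

theorem fa_fb_relation {c lam mu : ℂ} (h1 : lam ≠ -(Complex.I * c))
    (h2 : mu ≠ -(Complex.I * c)) (h3 : lam + mu ≠ -(Complex.I * c)) :
    fa c lam * fb c (lam + mu) * fb c mu + fb c lam * fb c (lam + mu) * fa c mu
      = fb c lam * fa c (lam + mu) * fb c mu := by
  have h1' : lam + Complex.I * c ≠ 0 := fun h => h1 (eq_neg_of_add_eq_zero_left h)
  have h2' : mu + Complex.I * c ≠ 0 := fun h => h2 (eq_neg_of_add_eq_zero_left h)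
  have h3' : lam + mu + Complex.I * c ≠ 0 := fun h => h3 (eq_neg_of_add_eq_zero_left h)
  unfold fa fb
  field_simp

/-- The six-vertex matrix `ř(λ) = b(λ)I₄ − a(λ)P` satisfies the Yang–Baxter
equation in braid form. -/
theorem sixvertex_yang_baxter (c : ℂ) (hc : c ≠ 0) (lam mu : ℂ)
    (h1 : lam ≠ -(Complex.I * c)) (h2 : mu ≠ -(Complex.I * c))
    (h3 : lam + mu ≠ -(Complex.I * c)) :
    r12 c lam * r23 c (lam + mu) * r12 c mu
      = r23 c mu * r12 c (lam + mu) * r23 c lam := by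
  rw [r12_eq, r12_eq, r12_eq, r23_eq, r23_eq, r23_eq]
  refine baxterize ?_ ?_ ?_ (fa_fb_relation h1 h2 h3)
  · rw [← Matrix.permMatrix_mul, show swap12 * swap12 = 1 from rfl, Matrix.permMatrix_one]
  · rw [← Matrix.permMatrix_mul, show swap23 * swap23 = 1 from rfl, Matrix.permMatrix_one]
  · simp only [← Matrix.permMatrix_mul]
    rfl

end Stmt1
end
end

section
/- Zamolodchikov relation for the B-operators: let T^α_β(λ) ∈ End(H) satisfy the graded Yang–Baxter algebra relations at (λ,μ), where λ−μ ≠ −ic, and set B_i(ν) = T^1_{i+1}(ν) for i ∈ {1,2}. Then for all i,k ∈ {1,2}: B_i(λ) B_k(μ) = b(λ−μ) B_i(μ) B_k(λ) − a(λ−μ) B_k(μ) B_i(λ). -/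
noncomputable section

namespace Stmt4

/-- The grading `p(1)=0`, `p(2)=p(3)=1` on the indices `{1,2,3}` (here `Fin 3`). -/
def pa (α : Fin 3) : ℕ := if α = 0 then 0 else 1

/-- `a(λ) = λ/(λ+ic)`. -/
def fa (c lam : ℂ) : ℂ := lam / (lam + Complex.I * c)

/-- `b(λ) = ic/(λ+ic)`. -/
def fb (c lam : ℂ) : ℂ := Complex.I * c / (lam + Complex.I * c)

/-- The gl(1|2)-invariant R-matrix in braid form:
`Ř^{αγ}_{βδ}(λ) = a(λ)(−1)^{p(α)p(γ)} δ^α_δ δ^γ_β + b(λ) δ^α_β δ^γ_δ`.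
Rows are indexed by `(α,γ)`, columns by `(β,δ)`. -/
def Rcheck (c lam : ℂ) : Matrix (Fin 3 × Fin 3) (Fin 3 × Fin 3) ℂ :=
  fun x y =>
    fa c lam * (-1 : ℂ) ^ (pa x.1 * pa x.2) *
        (if x.1 = y.2 then 1 else 0) * (if x.2 = y.1 then 1 else 0)
      + fb c lam * (if x.1 = y.1 then 1 else 0) * (if x.2 = y.2 then 1 else 0)

/-- The graded Yang–Baxter algebra relations at the pair `(λ,μ)` for a family of
operators `T^α_β(ν)` on `H`:
`Σ_{α',γ'} Ř^{αγ}_{α'γ'}(λ−μ) (−1)^{(p(α')+p(β))p(γ')} T^{α'}_β(λ) T^{γ'}_δ(μ)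
 = Σ_{β',δ'} (−1)^{(p(α)+p(β'))p(γ)} T^α_{β'}(μ) T^γ_{δ'}(λ) Ř^{β'δ'}_{βδ}(λ−μ)`. -/
def GYBA {H : Type*} [AddCommGroup H] [Module ℂ H] (c : ℂ)
    (T : Fin 3 → Fin 3 → ℂ → Module.End ℂ H) (lam mu : ℂ) : Prop :=
  ∀ α β γ δ : Fin 3,
    ∑ α' : Fin 3, ∑ γ' : Fin 3,
      (Rcheck c (lam - mu) (α, γ) (α', γ') * (-1 : ℂ) ^ ((pa α' + pa β) * pa γ')) •
        (T α' β lam * T γ' δ mu)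
    = ∑ β' : Fin 3, ∑ δ' : Fin 3,
      ((-1 : ℂ) ^ ((pa α + pa β') * pa γ) * Rcheck c (lam - mu) (β', δ') (β, δ)) •
        (T α β' mu * T γ δ' lam)

/-- Zamolodchikov relation for the B-operators `B_i(ν) = T^1_{i+1}(ν)`:
`B_i(λ) B_k(μ) = b(λ−μ) B_i(μ) B_k(λ) − a(λ−μ) B_k(μ) B_i(λ)`. -/
theorem zamolodchikov_B {H : Type*} [AddCommGroup H] [Module ℂ H]
    (c : ℂ) (hc : c ≠ 0) (lam mu : ℂ) (h : lam - mu ≠ -(Complex.I * c))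
    (T : Fin 3 → Fin 3 → ℂ → Module.End ℂ H)
    (hT : GYBA c T lam mu) :
    ∀ i k : Fin 2,
      T 0 i.succ lam * T 0 k.succ mu
        = fb c (lam - mu) • (T 0 i.succ mu * T 0 k.succ lam)
          - fa c (lam - mu) • (T 0 k.succ mu * T 0 i.succ lam) := by
  intro i k
  have hne : lam - mu + Complex.I * c ≠ 0 := fun h0 => h (eq_neg_of_add_eq_zero_left h0)
  have hab : fa c (lam - mu) + fb c (lam - mu) = 1 := by
    rw [fa, fb, ← add_div, div_self hne]
  have key := hT 0 i.succ 0 k.succ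
  fin_cases i <;> fin_cases k <;>
    simp [Fin.sum_univ_three, Rcheck, pa, hab] at key ⊢ <;>
    rw [key] <;> module

end Stmt4
end
end

section
/- Commutation of A with B: let T^α_β(λ) ∈ End(H) satisfy the graded Yang–Baxter algebra relations at (λ,μ) and at (μ,λ), where μ−λ ∉ {0, ic, −ic}, and set A(ν) = T^1_1(ν), B_i(ν) = T^1_{i+1}(ν) for i ∈ {1,2}. Then for i ∈ {1,2}: A(λ) B_i(μ) = −(b(μ−λ)/a(μ−λ)) B_i(λ) A(μ) + (1/a(μ−λ)) B_i(μ) A(λ). -/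
noncomputable section

namespace Stmt5

/-- The grading `p(1)=0`, `p(2)=p(3)=1` on the indices `{1,2,3}` (here `Fin 3`). -/
def pa (α : Fin 3) : ℕ := if α = 0 then 0 else 1

/-- `a(λ) = λ/(λ+ic)`. -/
def fa (c lam : ℂ) : ℂ := lam / (lam + Complex.I * c)

/-- `b(λ) = ic/(λ+ic)`. -/
def fb (c lam : ℂ) : ℂ := Complex.I * c / (lam + Complex.I * c)

/-- The gl(1|2)-invariant R-matrix in braid form:
`Ř^{αγ}_{βδ}(λ) = a(λ)(−1)^{p(α)p(γ)} δ^α_δ δ^γ_β + b(λ) δ^α_β δ^γ_δ`.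
Rows are indexed by `(α,γ)`, columns by `(β,δ)`. -/
def Rcheck (c lam : ℂ) : Matrix (Fin 3 × Fin 3) (Fin 3 × Fin 3) ℂ :=
  fun x y =>
    fa c lam * (-1 : ℂ) ^ (pa x.1 * pa x.2) *
        (if x.1 = y.2 then 1 else 0) * (if x.2 = y.1 then 1 else 0)
      + fb c lam * (if x.1 = y.1 then 1 else 0) * (if x.2 = y.2 then 1 else 0)

/-- The graded Yang–Baxter algebra relations at the pair `(λ,μ)` for a family of
operators `T^α_β(ν)` on `H`:
`Σ_{α',γ'} Ř^{αγ}_{α'γ'}(λ−μ) (−1)^{(p(α')+p(β))p(γ')} T^{α'}_β(λ) T^{γ'}_δ(μ)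
 = Σ_{β',δ'} (−1)^{(p(α)+p(β'))p(γ)} T^α_{β'}(μ) T^γ_{δ'}(λ) Ř^{β'δ'}_{βδ}(λ−μ)`. -/
def GYBA {H : Type*} [AddCommGroup H] [Module ℂ H] (c : ℂ)
    (T : Fin 3 → Fin 3 → ℂ → Module.End ℂ H) (lam mu : ℂ) : Prop :=
  ∀ α β γ δ : Fin 3,
    ∑ α' : Fin 3, ∑ γ' : Fin 3,
      (Rcheck c (lam - mu) (α, γ) (α', γ') * (-1 : ℂ) ^ ((pa α' + pa β) * pa γ')) •
        (T α' β lam * T γ' δ mu)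
    = ∑ β' : Fin 3, ∑ δ' : Fin 3,
      ((-1 : ℂ) ^ ((pa α + pa β') * pa γ) * Rcheck c (lam - mu) (β', δ') (β, δ)) •
        (T α β' mu * T γ δ' lam)

/-- Commutation of `A(ν) = T^1_1(ν)` with `B_i(ν) = T^1_{i+1}(ν)`:
`A(λ) B_i(μ) = −(b(μ−λ)/a(μ−λ)) B_i(λ) A(μ) + (1/a(μ−λ)) B_i(μ) A(λ)`. -/
theorem A_B_commutation {H : Type*} [AddCommGroup H] [Module ℂ H]
    (c : ℂ) (hc : c ≠ 0) (lam mu : ℂ)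
    (h0 : mu - lam ≠ 0) (h1 : mu - lam ≠ Complex.I * c)
    (h2 : mu - lam ≠ -(Complex.I * c))
    (T : Fin 3 → Fin 3 → ℂ → Module.End ℂ H)
    (hT : GYBA c T lam mu) (hT' : GYBA c T mu lam) :
    ∀ i : Fin 2,
      T 0 0 lam * T 0 i.succ mu
        = (-(fb c (mu - lam) / fa c (mu - lam))) • (T 0 i.succ lam * T 0 0 mu)
          + (1 / fa c (mu - lam)) • (T 0 i.succ mu * T 0 0 lam) := by
  intro i
  have hd : mu - lam + Complex.I * c ≠ 0 := fun h => h2 (eq_neg_of_add_eq_zero_left h)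
  have ha : fa c (mu - lam) ≠ 0 := div_ne_zero h0 hd
  have hab : fa c (mu - lam) + fb c (mu - lam) = 1 := by
    rw [fa, fb, ← add_div, div_self hd]
  have key : T 0 i.succ mu * T 0 0 lam
      = fa c (mu - lam) • (T 0 0 lam * T 0 i.succ mu)
        + fb c (mu - lam) • (T 0 i.succ lam * T 0 0 mu) := by
    have h := hT' 0 i.succ 0 0
    fin_cases i <;> simpa [Fin.sum_univ_three, Rcheck, pa, hab] using h
  rw [key, smul_add, smul_smul, smul_smul, one_div_mul_cancel ha, one_smul, neg_smul,
    one_div_mul_eq_div]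
  abel

end Stmt5
end
end

section
/- Commutation of D with B: let T^α_β(λ) ∈ End(H) satisfy the graded Yang–Baxter algebra relations at (λ,μ) and at (μ,λ), where λ−μ ∉ {0, ic, −ic}, and set B_i(ν) = T^1_{i+1}(ν), D^i_j(ν) = T^{i+1}_{j+1}(ν) for i,j ∈ {1,2}. Then for all i,j,l ∈ {1,2}: D^i_j(λ) B_l(μ) = (b(λ−μ)/a(λ−μ)) B_j(λ) D^i_l(μ) − (1/a(λ−μ)) Σ_{j',l' ∈ {1,2}} B_{j'}(μ) D^i_{l'}(λ) ř^{j'l'}_{jl}(λ−μ). -/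
noncomputable section

namespace Stmt6

/-- The grading `p(1)=0`, `p(2)=p(3)=1` on the indices `{1,2,3}` (here `Fin 3`). -/
def pa (α : Fin 3) : ℕ := if α = 0 then 0 else 1

/-- `a(λ) = λ/(λ+ic)`. -/
def fa (c lam : ℂ) : ℂ := lam / (lam + Complex.I * c)

/-- `b(λ) = ic/(λ+ic)`. -/
def fb (c lam : ℂ) : ℂ := Complex.I * c / (lam + Complex.I * c)

/-- The gl(1|2)-invariant R-matrix in braid form:
`Ř^{αγ}_{βδ}(λ) = a(λ)(−1)^{p(α)p(γ)} δ^α_δ δ^γ_β + b(λ) δ^α_β δ^γ_δ`.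
Rows are indexed by `(α,γ)`, columns by `(β,δ)`. -/
def Rcheck (c lam : ℂ) : Matrix (Fin 3 × Fin 3) (Fin 3 × Fin 3) ℂ :=
  fun x y =>
    fa c lam * (-1 : ℂ) ^ (pa x.1 * pa x.2) *
        (if x.1 = y.2 then 1 else 0) * (if x.2 = y.1 then 1 else 0)
      + fb c lam * (if x.1 = y.1 then 1 else 0) * (if x.2 = y.2 then 1 else 0)

/-- The graded Yang–Baxter algebra relations at the pair `(λ,μ)` for a family of
operators `T^α_β(ν)` on `H`:
`Σ_{α',γ'} Ř^{αγ}_{α'γ'}(λ−μ) (−1)^{(p(α')+p(β))p(γ')} T^{α'}_β(λ) T^{γ'}_δ(μ)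
 = Σ_{β',δ'} (−1)^{(p(α)+p(β'))p(γ)} T^α_{β'}(μ) T^γ_{δ'}(λ) Ř^{β'δ'}_{βδ}(λ−μ)`. -/
def GYBA {H : Type*} [AddCommGroup H] [Module ℂ H] (c : ℂ)
    (T : Fin 3 → Fin 3 → ℂ → Module.End ℂ H) (lam mu : ℂ) : Prop :=
  ∀ α β γ δ : Fin 3,
    ∑ α' : Fin 3, ∑ γ' : Fin 3,
      (Rcheck c (lam - mu) (α, γ) (α', γ') * (-1 : ℂ) ^ ((pa α' + pa β) * pa γ')) •
        (T α' β lam * T γ' δ mu)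
    = ∑ β' : Fin 3, ∑ δ' : Fin 3,
      ((-1 : ℂ) ^ ((pa α + pa β') * pa γ) * Rcheck c (lam - mu) (β', δ') (β, δ)) •
        (T α β' mu * T γ δ' lam)

/-- The six-vertex matrix `ř(λ)` with entries
`ř^{ik}_{jl}(λ) = b(λ) δ^i_j δ^k_l − a(λ) δ^i_l δ^k_j`.
Rows are indexed by `(i,k)`, columns by `(j,l)`. -/
def rcheck (c lam : ℂ) : Matrix (Fin 2 × Fin 2) (Fin 2 × Fin 2) ℂ :=
  fun x y =>
    fb c lam * (if x.1 = y.1 then 1 else 0) * (if x.2 = y.2 then 1 else 0)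
      - fa c lam * (if x.1 = y.2 then 1 else 0) * (if x.2 = y.1 then 1 else 0)

/-- Commutation of `D^i_j(ν) = T^{i+1}_{j+1}(ν)` with `B_i(ν) = T^1_{i+1}(ν)`:
`D^i_j(λ) B_l(μ) = (b(λ−μ)/a(λ−μ)) B_j(λ) D^i_l(μ)
   − (1/a(λ−μ)) Σ_{j',l'} B_{j'}(μ) D^i_{l'}(λ) ř^{j'l'}_{jl}(λ−μ)`. -/
theorem D_B_commutation {H : Type*} [AddCommGroup H] [Module ℂ H]
    (c : ℂ) (hc : c ≠ 0) (lam mu : ℂ)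
    (h0 : lam - mu ≠ 0) (h1 : lam - mu ≠ Complex.I * c)
    (h2 : lam - mu ≠ -(Complex.I * c))
    (T : Fin 3 → Fin 3 → ℂ → Module.End ℂ H)
    (hT : GYBA c T lam mu) (hT' : GYBA c T mu lam) :
    ∀ i j l : Fin 2,
      T i.succ j.succ lam * T 0 l.succ mu
        = (fb c (lam - mu) / fa c (lam - mu)) • (T 0 j.succ lam * T i.succ l.succ mu)
          - (1 / fa c (lam - mu)) •
              ∑ j' : Fin 2, ∑ l' : Fin 2,
                rcheck c (lam - mu) (j', l') (j, l) • (T 0 j'.succ mu * T i.succ l'.succ lam) := by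
  intro i j l
  have ha : fa c (lam - mu) ≠ 0 :=
    div_ne_zero h0 fun h => h2 (eq_neg_of_add_eq_zero_left h)
  have key : fa c (lam - mu) • (T i.succ j.succ lam * T 0 l.succ mu)
      = fb c (lam - mu) • (T 0 j.succ lam * T i.succ l.succ mu)
        - ∑ j' : Fin 2, ∑ l' : Fin 2,
            rcheck c (lam - mu) (j', l') (j, l) • (T 0 j'.succ mu * T i.succ l'.succ lam) := by
    have h := hT 0 j.succ i.succ l.succ
    simp [Fin.sum_univ_succ (n := 2), Rcheck, rcheck, pa, Fin.succ_ne_zero,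
      (Fin.succ_ne_zero _).symm, add_smul, sub_smul, ite_smul, Finset.sum_add_distrib,
      Finset.sum_sub_distrib, mul_ite, ite_mul, -Fin.sum_univ_two] at h ⊢
    linear_combination (norm := module) h
  rw [← smul_right_injective _ ha |>.eq_iff, key, smul_sub, smul_smul, smul_smul,
    mul_div_cancel₀ _ ha, mul_one_div_cancel ha, one_smul]

end Stmt6
end
end

section
/- The D-block is a representation of the gl(2) Yang–Baxter algebra: let T^α_β(λ) ∈ End(H) satisfy the graded Yang–Baxter algebra relations at (λ,μ), where λ−μ ≠ −ic, and set D^i_j(ν) = T^{i+1}_{j+1}(ν) for i,j ∈ {1,2}. Then for all i,j,k,l ∈ {1,2}: Σ_{i',k' ∈ {1,2}} ř^{ik}_{i'k'}(λ−μ) D^{i'}_j(λ) D^{k'}_l(μ) = Σ_{j',l' ∈ {1,2}} D^i_{j'}(μ) D^k_{l'}(λ) ř^{j'l'}_{jl}(λ−μ). -/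
noncomputable section

namespace Stmt7

/-- The grading `p(1)=0`, `p(2)=p(3)=1` on the indices `{1,2,3}` (here `Fin 3`). -/
def pa (α : Fin 3) : ℕ := if α = 0 then 0 else 1

/-- `a(λ) = λ/(λ+ic)`. -/
def fa (c lam : ℂ) : ℂ := lam / (lam + Complex.I * c)

/-- `b(λ) = ic/(λ+ic)`. -/
def fb (c lam : ℂ) : ℂ := Complex.I * c / (lam + Complex.I * c)

/-- The gl(1|2)-invariant R-matrix in braid form:
`Ř^{αγ}_{βδ}(λ) = a(λ)(−1)^{p(α)p(γ)} δ^α_δ δ^γ_β + b(λ) δ^α_β δ^γ_δ`.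
Rows are indexed by `(α,γ)`, columns by `(β,δ)`. -/
def Rcheck (c lam : ℂ) : Matrix (Fin 3 × Fin 3) (Fin 3 × Fin 3) ℂ :=
  fun x y =>
    fa c lam * (-1 : ℂ) ^ (pa x.1 * pa x.2) *
        (if x.1 = y.2 then 1 else 0) * (if x.2 = y.1 then 1 else 0)
      + fb c lam * (if x.1 = y.1 then 1 else 0) * (if x.2 = y.2 then 1 else 0)

/-- The graded Yang–Baxter algebra relations at the pair `(λ,μ)` for a family of
operators `T^α_β(ν)` on `H`:
`Σ_{α',γ'} Ř^{αγ}_{α'γ'}(λ−μ) (−1)^{(p(α')+p(β))p(γ')} T^{α'}_β(λ) T^{γ'}_δ(μ)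
 = Σ_{β',δ'} (−1)^{(p(α)+p(β'))p(γ)} T^α_{β'}(μ) T^γ_{δ'}(λ) Ř^{β'δ'}_{βδ}(λ−μ)`. -/
def GYBA {H : Type*} [AddCommGroup H] [Module ℂ H] (c : ℂ)
    (T : Fin 3 → Fin 3 → ℂ → Module.End ℂ H) (lam mu : ℂ) : Prop :=
  ∀ α β γ δ : Fin 3,
    ∑ α' : Fin 3, ∑ γ' : Fin 3,
      (Rcheck c (lam - mu) (α, γ) (α', γ') * (-1 : ℂ) ^ ((pa α' + pa β) * pa γ')) •
        (T α' β lam * T γ' δ mu)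
    = ∑ β' : Fin 3, ∑ δ' : Fin 3,
      ((-1 : ℂ) ^ ((pa α + pa β') * pa γ) * Rcheck c (lam - mu) (β', δ') (β, δ)) •
        (T α β' mu * T γ δ' lam)

/-- The six-vertex matrix `ř(λ)` with entries
`ř^{ik}_{jl}(λ) = b(λ) δ^i_j δ^k_l − a(λ) δ^i_l δ^k_j`.
Rows are indexed by `(i,k)`, columns by `(j,l)`. -/
def rcheck (c lam : ℂ) : Matrix (Fin 2 × Fin 2) (Fin 2 × Fin 2) ℂ :=
  fun x y =>
    fb c lam * (if x.1 = y.1 then 1 else 0) * (if x.2 = y.2 then 1 else 0)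
      - fa c lam * (if x.1 = y.2 then 1 else 0) * (if x.2 = y.1 then 1 else 0)

@[simp] lemma pa_succ (i : Fin 2) : pa i.succ = 1 := by simp [pa]

/-- The odd-odd block of `Rcheck` is `rcheck`. -/
lemma Rcheck_succ_succ (c lam : ℂ) (i k j l : Fin 2) :
    Rcheck c lam (i.succ, k.succ) (j.succ, l.succ) = rcheck c lam (i, k) (j, l) := by
  simp only [Rcheck, rcheck, pa_succ, Fin.succ_inj]
  ring

lemma Rcheck_apply_eq_zero_of_left (c lam : ℂ) (i k : Fin 2) {x y : Fin 3} (h : x = 0 ∨ y = 0) :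
    Rcheck c lam (i.succ, k.succ) (x, y) = 0 := by
  rcases h with rfl | rfl <;> simp [Rcheck]

lemma Rcheck_apply_eq_zero_of_right (c lam : ℂ) (j l : Fin 2) {x y : Fin 3} (h : x = 0 ∨ y = 0) :
    Rcheck c lam (x, y) (j.succ, l.succ) = 0 := by
  rcases h with rfl | rfl <;> simp [Rcheck, (Fin.succ_ne_zero _).symm]

/-- The D-block `D^i_j(ν) = T^{i+1}_{j+1}(ν)` of the gl(1|2) monodromy matrix is
a representation of the gl(2) Yang–Baxter algebra with R-matrix `ř`:
`Σ_{i',k'} ř^{ik}_{i'k'}(λ−μ) D^{i'}_j(λ) D^{k'}_l(μ)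
  = Σ_{j',l'} D^i_{j'}(μ) D^k_{l'}(λ) ř^{j'l'}_{jl}(λ−μ)`. -/
theorem D_block_gl2_YBA {H : Type*} [AddCommGroup H] [Module ℂ H]
    (c : ℂ) (hc : c ≠ 0) (lam mu : ℂ) (h : lam - mu ≠ -(Complex.I * c))
    (T : Fin 3 → Fin 3 → ℂ → Module.End ℂ H)
    (hT : GYBA c T lam mu) :
    ∀ i j k l : Fin 2,
      ∑ i' : Fin 2, ∑ k' : Fin 2,
        rcheck c (lam - mu) (i, k) (i', k') • (T i'.succ j.succ lam * T k'.succ l.succ mu)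
      = ∑ j' : Fin 2, ∑ l' : Fin 2,
        rcheck c (lam - mu) (j', l') (j, l) • (T i.succ j'.succ mu * T k.succ l'.succ lam) := by
  intro i j k l
  have hT' := hT i.succ j.succ k.succ l.succ
  simpa only [Fin.sum_univ_succ (n := 2), Rcheck_succ_succ, Rcheck_apply_eq_zero_of_left,
    Rcheck_apply_eq_zero_of_right, true_or, or_true, pa_succ, Nat.reduceAdd, mul_one, one_mul,
    even_two.neg_one_pow, zero_mul, mul_zero, zero_smul, Finset.sum_const_zero, zero_add] using hT'

end Stmt7
end
end

section
/- Invariance of the vacuum subspace under D (Lemma 1): let T^α_β(λ) ∈ End(H) satisfy the graded Yang–Baxter algebra relations at every pair (λ,μ) ∈ D×D with λ−μ ≠ −ic, where D ⊆ ℂ, and set A(ν) = T^1_1(ν), C^i(ν) = T^{i+1}_1(ν), D^i_j(ν) = T^{i+1}_{j+1}(ν). Let a₁ : D → ℂ, and let Φ ∈ H satisfy A(ν)Φ = a₁(ν)Φ and C^1(ν)Φ = C^2(ν)Φ = 0 for all ν ∈ D. Then for all λ, μ ∈ D with μ ≠ λ and λ−μ ∉ {ic, −ic}, and all i,j,k ∈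 {1,2}: A(μ)(D^i_j(λ)Φ) = a₁(μ) D^i_j(λ)Φ and C^k(μ)(D^i_j(λ)Φ) = 0. -/
noncomputable section

namespace Stmt8

/-- The grading `p(1)=0`, `p(2)=p(3)=1` on the indices `{1,2,3}` (here `Fin 3`). -/
def pa (α : Fin 3) : ℕ := if α = 0 then 0 else 1

/-- `a(λ) = λ/(λ+ic)`. -/
def fa (c lam : ℂ) : ℂ := lam / (lam + Complex.I * c)

/-- `b(λ) = ic/(λ+ic)`. -/
def fb (c lam : ℂ) : ℂ := Complex.I * c / (lam + Complex.I * c)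

/-- The gl(1|2)-invariant R-matrix in braid form:
`Ř^{αγ}_{βδ}(λ) = a(λ)(−1)^{p(α)p(γ)} δ^α_δ δ^γ_β + b(λ) δ^α_β δ^γ_δ`.
Rows are indexed by `(α,γ)`, columns by `(β,δ)`. -/
def Rcheck (c lam : ℂ) : Matrix (Fin 3 × Fin 3) (Fin 3 × Fin 3) ℂ :=
  fun x y =>
    fa c lam * (-1 : ℂ) ^ (pa x.1 * pa x.2) *
        (if x.1 = y.2 then 1 else 0) * (if x.2 = y.1 then 1 else 0)
      + fb c lam * (if x.1 = y.1 then 1 else 0) * (if x.2 = y.2 then 1 else 0)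

/-- The graded Yang–Baxter algebra relations at the pair `(λ,μ)` for a family of
operators `T^α_β(ν)` on `H`:
`Σ_{α',γ'} Ř^{αγ}_{α'γ'}(λ−μ) (−1)^{(p(α')+p(β))p(γ')} T^{α'}_β(λ) T^{γ'}_δ(μ)
 = Σ_{β',δ'} (−1)^{(p(α)+p(β'))p(γ)} T^α_{β'}(μ) T^γ_{δ'}(λ) Ř^{β'δ'}_{βδ}(λ−μ)`. -/
def GYBA {H : Type*} [AddCommGroup H] [Module ℂ H] (c : ℂ)
    (T : Fin 3 → Fin 3 → ℂ → Module.End ℂ H) (lam mu : ℂ) : Prop :=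
  ∀ α β γ δ : Fin 3,
    ∑ α' : Fin 3, ∑ γ' : Fin 3,
      (Rcheck c (lam - mu) (α, γ) (α', γ') * (-1 : ℂ) ^ ((pa α' + pa β) * pa γ')) •
        (T α' β lam * T γ' δ mu)
    = ∑ β' : Fin 3, ∑ δ' : Fin 3,
      ((-1 : ℂ) ^ ((pa α + pa β') * pa γ) * Rcheck c (lam - mu) (β', δ') (β, δ)) •
        (T α β' mu * T γ δ' lam)

/-- Componentwise form of the graded Yang–Baxter relations, with the Kronecker deltas of the
R-matrix contracted. -/
theorem GYBA.component {H : Type*} [AddCommGroup H] [Module ℂ H] {c : ℂ}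
    {T : Fin 3 → Fin 3 → ℂ → Module.End ℂ H} {lam mu : ℂ} (h : GYBA c T lam mu)
    (α β γ δ : Fin 3) (Φ : H) :
    (fa c (lam - mu) * (-1 : ℂ) ^ (pa α * pa γ) * (-1 : ℂ) ^ ((pa γ + pa β) * pa α)) •
        T γ β lam (T α δ mu Φ)
      + (fb c (lam - mu) * (-1 : ℂ) ^ ((pa α + pa β) * pa γ)) • T α β lam (T γ δ mu Φ)
    = ((-1 : ℂ) ^ ((pa α + pa δ) * pa γ) * (fa c (lam - mu) * (-1 : ℂ) ^ (pa δ * pa β))) •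
        T α δ mu (T γ β lam Φ)
      + ((-1 : ℂ) ^ ((pa α + pa β) * pa γ) * fb c (lam - mu)) • T α β mu (T γ δ lam Φ) := by
  have key := congrArg (fun f : Module.End ℂ H => f Φ) (h α β γ δ)
  simpa [Rcheck, add_mul, mul_add, add_smul, Finset.sum_add_distrib, ite_smul,
    LinearMap.add_apply] using key

/-- If `T^α_0(μ)Φ = s • Φ` with `s = 0` unless `α = 0`, and `T^γ_0(λ)` and `T^γ_0(μ)` annihilate
`Φ`, then `T^γ_β(λ)Φ` satisfies the same equation as `Φ`. -/
theorem GYBA.apply_of_annihilates {H : Type*} [AddCommGroup H] [Module ℂ H] {c : ℂ}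
    {T : Fin 3 → Fin 3 → ℂ → Module.End ℂ H} {lam mu : ℂ} (h : GYBA c T lam mu)
    (hfa : fa c (lam - mu) ≠ 0) {α γ : Fin 3} (β : Fin 3) {Φ : H} {s : ℂ}
    (hα : T α 0 mu Φ = s • Φ) (hs : α ≠ 0 → s = 0)
    (hlam : T γ 0 lam Φ = 0) (hmu : T γ 0 mu Φ = 0) :
    T α 0 mu (T γ β lam Φ) = s • T γ β lam Φ := by
  have key := h.component α β γ 0 Φ
  rw [hα, hlam, hmu] at key
  by_cases hα0 : α = 0
  · subst hα0
    simpa [pa, hfa] using key.symm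
  · rw [hs hα0] at key ⊢
    by_cases hγ0 : γ = 0 <;> simpa [pa, hfa, hα0, hγ0] using key.symm

/-- Invariance of the vacuum subspace under the D-operators (Lemma 1):
if `A(ν)Φ = a₁(ν)Φ` and `C^1(ν)Φ = C^2(ν)Φ = 0` for all `ν ∈ D`, then the same
holds for `D^i_j(λ)Φ`.  Here `A(ν) = T^1_1(ν)`, `C^i(ν) = T^{i+1}_1(ν)` and
`D^i_j(ν) = T^{i+1}_{j+1}(ν)`. -/
theorem vacuum_subspace_invariant {H : Type*} [AddCommGroup H] [Module ℂ H]
    (c : ℂ) (hc : c ≠ 0) (D : Set ℂ)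
    (T : Fin 3 → Fin 3 → ℂ → Module.End ℂ H)
    (hT : ∀ lam ∈ D, ∀ mu ∈ D, lam - mu ≠ -(Complex.I * c) → GYBA c T lam mu)
    (a1 : ℂ → ℂ) (Φ : H)
    (hA : ∀ ν ∈ D, T 0 0 ν Φ = a1 ν • Φ)
    (hC : ∀ ν ∈ D, ∀ i : Fin 2, T i.succ 0 ν Φ = 0) :
    ∀ lam ∈ D, ∀ mu ∈ D, mu ≠ lam →
      lam - mu ≠ Complex.I * c → lam - mu ≠ -(Complex.I * c) →
      ∀ i j k : Fin 2,
        T 0 0 mu (T i.succ j.succ lam Φ) = a1 mu • T i.succ j.succ lam Φ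
        ∧ T k.succ 0 mu (T i.succ j.succ lam Φ) = 0 := by
  intro lam hlam mu hmu hne _ hpole i j k
  have hfa : fa c (lam - mu) ≠ 0 :=
    div_ne_zero (sub_ne_zero.mpr hne.symm) fun h => hpole (eq_neg_of_add_eq_zero_left h)
  have h := hT lam hlam mu hmu hpole
  refine ⟨h.apply_of_annihilates hfa _ (hA mu hmu) (absurd rfl) (hC lam hlam i) (hC mu hmu i), ?_⟩
  simpa using h.apply_of_annihilates hfa j.succ (s := 0) (by simpa using hC mu hmu k)
    (fun _ => rfl) (hC lam hlam i) (hC mu hmu i)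

end Stmt8
end
end

section
/- Corollary to the vacuum-subspace lemma: in the setting of the gl(1|2) graded Yang–Baxter algebra, let Ω ∈ H satisfy A(ν)Ω = a₁(ν)Ω and C^1(ν)Ω = C^2(ν)Ω = 0 for all ν ∈ D, and let μ₁, …, μ_M ∈ D be pairwise distinct with μ_k − μ_l ∉ {ic, −ic} for all k ≠ l. Then for every ν ∈ D with ν ∉ {μ₁,…,μ_M} and ν − μ_k ∉ {ic, −ic} for all k, the vector Ψ = D^1_2(μ₁) D^1_2(μ₂) ⋯ D^1_2(μ_M) Ω satisfies A(ν)Ψ = a₁(ν)Ψ and C^1(ν)Ψ = C^2(ν)Ψ = 0; i.e., Ψ lies in the vacuum subspace H₀. -/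
noncomputable section

namespace Stmt9

/-- The grading `p(1)=0`, `p(2)=p(3)=1` on the indices `{1,2,3}` (here `Fin 3`). -/
def pa (α : Fin 3) : ℕ := if α = 0 then 0 else 1

/-- `a(λ) = λ/(λ+ic)`. -/
def fa (c lam : ℂ) : ℂ := lam / (lam + Complex.I * c)

/-- `b(λ) = ic/(λ+ic)`. -/
def fb (c lam : ℂ) : ℂ := Complex.I * c / (lam + Complex.I * c)

/-- The gl(1|2)-invariant R-matrix in braid form:
`Ř^{αγ}_{βδ}(λ) = a(λ)(−1)^{p(α)p(γ)} δ^α_δ δ^γ_β + b(λ) δ^α_β δ^γ_δ`.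
Rows are indexed by `(α,γ)`, columns by `(β,δ)`. -/
def Rcheck (c lam : ℂ) : Matrix (Fin 3 × Fin 3) (Fin 3 × Fin 3) ℂ :=
  fun x y =>
    fa c lam * (-1 : ℂ) ^ (pa x.1 * pa x.2) *
        (if x.1 = y.2 then 1 else 0) * (if x.2 = y.1 then 1 else 0)
      + fb c lam * (if x.1 = y.1 then 1 else 0) * (if x.2 = y.2 then 1 else 0)

/-- The graded Yang–Baxter algebra relations at the pair `(λ,μ)` for a family of
operators `T^α_β(ν)` on `H`:
`Σ_{α',γ'} Ř^{αγ}_{α'γ'}(λ−μ) (−1)^{(p(α')+p(β))p(γ')} T^{α'}_β(λ) T^{γ'}_δ(μ)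
 = Σ_{β',δ'} (−1)^{(p(α)+p(β'))p(γ)} T^α_{β'}(μ) T^γ_{δ'}(λ) Ř^{β'δ'}_{βδ}(λ−μ)`. -/
def GYBA {H : Type*} [AddCommGroup H] [Module ℂ H] (c : ℂ)
    (T : Fin 3 → Fin 3 → ℂ → Module.End ℂ H) (lam mu : ℂ) : Prop :=
  ∀ α β γ δ : Fin 3,
    ∑ α' : Fin 3, ∑ γ' : Fin 3,
      (Rcheck c (lam - mu) (α, γ) (α', γ') * (-1 : ℂ) ^ ((pa α' + pa β) * pa γ')) •
        (T α' β lam * T γ' δ mu)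
    = ∑ β' : Fin 3, ∑ δ' : Fin 3,
      ((-1 : ℂ) ^ ((pa α + pa β') * pa γ) * Rcheck c (lam - mu) (β', δ') (β, δ)) •
        (T α β' mu * T γ δ' lam)

/-- If `C^i(lam)` and `C^i(mu)` annihilate `v`, then `A(mu)` commutes with `D^1_2(lam)` on `v`. -/
theorem A_apply_D12 {H : Type*} [AddCommGroup H] [Module ℂ H] {c : ℂ}
    {T : Fin 3 → Fin 3 → ℂ → Module.End ℂ H} {lam mu : ℂ} (hG : GYBA c T lam mu)
    (hne : lam ≠ mu) (hic : lam - mu ≠ -(Complex.I * c)) {v : H}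
    (hlam : T 1 0 lam v = 0) (hmu : T 1 0 mu v = 0) :
    T 0 0 mu (T 1 2 lam v) = T 1 2 lam (T 0 0 mu v) := by
  have ha : fa c (lam - mu) ≠ 0 :=
    div_ne_zero (sub_ne_zero.2 hne) fun h => hic (eq_neg_of_add_eq_zero_left h)
  have h := congrArg (fun f : Module.End ℂ H => f v) (hG 0 2 1 0)
  refine (smul_right_injective H ha ?_).symm
  simpa [Fin.sum_univ_three, Rcheck, pa, hlam, hmu] using h

/-- If `C^i(lam)` and `C^i(mu)` annihilate `v`, then `C^i(mu)` annihilates `D^1_2(lam) v`. -/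
theorem C_apply_D12 {H : Type*} [AddCommGroup H] [Module ℂ H] {c : ℂ}
    {T : Fin 3 → Fin 3 → ℂ → Module.End ℂ H} {lam mu : ℂ} (hG : GYBA c T lam mu)
    (hne : lam ≠ mu) (hic : lam - mu ≠ -(Complex.I * c)) {v : H}
    (hlam : T 1 0 lam v = 0) (hmu : ∀ i : Fin 2, T i.succ 0 mu v = 0) (i : Fin 2) :
    T i.succ 0 mu (T 1 2 lam v) = 0 := by
  have ha : fa c (lam - mu) ≠ 0 :=
    div_ne_zero (sub_ne_zero.2 hne) fun h => hic (eq_neg_of_add_eq_zero_left h)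
  have h1 : T 1 0 mu v = 0 := hmu 0
  have h2 : T 2 0 mu v = 0 := hmu 1
  have h := congrArg (fun f : Module.End ℂ H => f v) (hG i.succ 2 1 0)
  fin_cases i <;> simpa [Fin.sum_univ_three, Rcheck, pa, hlam, h1, h2, ha] using h

/-- Corollary to the vacuum-subspace lemma: the vector
`Ψ = D^1_2(μ₁) D^1_2(μ₂) ⋯ D^1_2(μ_M) Ω` lies in the vacuum subspace `H₀`, i.e.
`A(ν)Ψ = a₁(ν)Ψ` and `C^1(ν)Ψ = C^2(ν)Ψ = 0`.  Here `A(ν) = T^1_1(ν)`,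
`C^i(ν) = T^{i+1}_1(ν)` and `D^1_2(ν) = T^2_3(ν)` (Lean: `T 1 2 ν`). -/
theorem D12_product_in_vacuum_subspace {H : Type*} [AddCommGroup H] [Module ℂ H]
    (c : ℂ) (hc : c ≠ 0) (D : Set ℂ)
    (T : Fin 3 → Fin 3 → ℂ → Module.End ℂ H)
    (hT : ∀ lam ∈ D, ∀ mu ∈ D, lam - mu ≠ -(Complex.I * c) → GYBA c T lam mu)
    (a1 : ℂ → ℂ) (Ω : H)
    (hA : ∀ ν ∈ D, T 0 0 ν Ω = a1 ν • Ω)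
    (hC : ∀ ν ∈ D, ∀ i : Fin 2, T i.succ 0 ν Ω = 0)
    (M : ℕ) (mus : Fin M → ℂ) (hmusD : ∀ k, mus k ∈ D)
    (hinj : Function.Injective mus)
    (hmm : ∀ k l, k ≠ l →
      mus k - mus l ≠ Complex.I * c ∧ mus k - mus l ≠ -(Complex.I * c))
    (ν : ℂ) (hν : ν ∈ D) (hνm : ν ∉ Set.range mus)
    (hνic : ∀ k, ν - mus k ≠ Complex.I * c ∧ ν - mus k ≠ -(Complex.I * c)) :
    T 0 0 ν ((List.ofFn fun k : Fin M => T 1 2 (mus k)).prod Ω)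
        = a1 ν • (List.ofFn fun k : Fin M => T 1 2 (mus k)).prod Ω
      ∧ ∀ i : Fin 2,
        T i.succ 0 ν ((List.ofFn fun k : Fin M => T 1 2 (mus k)).prod Ω) = 0 := by
  induction M generalizing ν with
  | zero => exact ⟨hA ν hν, hC ν hν⟩
  | succ M ih =>
    have ih' := ih (fun k => mus k.succ) (fun k => hmusD _)
      (hinj.comp (Fin.succ_injective M))
      (fun k l hkl => hmm _ _ fun h => hkl (Fin.succ_injective M h))
    obtain ⟨hAν, hCν⟩ := ih' ν hν (fun ⟨k, hk⟩ => hνm ⟨k.succ, hk⟩) (fun k => hνic k.succ)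
    obtain ⟨-, hCμ⟩ := ih' (mus 0) (hmusD 0)
      (fun ⟨k, hk⟩ => Fin.succ_ne_zero k (hinj hk))
      (fun k => hmm 0 k.succ (Fin.succ_ne_zero k).symm)
    have hne : mus 0 ≠ ν := fun h => hνm ⟨0, h⟩
    have hic : mus 0 - ν ≠ -(Complex.I * c) := fun h =>
      (hνic 0).1 (by rw [← neg_sub, h, neg_neg])
    have hG := hT _ (hmusD 0) ν hν hic
    rw [List.ofFn_succ, List.prod_cons, Module.End.mul_apply]
    refine ⟨?_, C_apply_D12 hG hne hic (hCμ 0) hCν⟩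
    rw [A_apply_D12 hG hne hic (hCμ 0) (hCν 0), hAν, map_smul]

end Stmt9
end
end

section
/- Iterated commutation of A with a product of B-operators (equation (4.1)): let H be a complex vector space and let A(ν), B₁(ν), B₂(ν) ∈ End(H) be given for ν ∈ {λ, λ₁, …, λ_N}, these points being pairwise distinct with all pairwise differences not in {ic, −ic}. Assume for all ν, ν' among these points and all i,k ∈ {1,2}: B_i(ν)B_k(ν') = b(ν−ν')B_i(ν')B_k(ν) − a(ν−ν')B_k(ν')B_i(ν), and A(ν)B_i(ν') = −(b(ν'−ν)/a(ν'−ν))B_i(ν)A(ν') + (1/a(ν'−ν))B_i(ν')A(ν). Then for every multi-index (i₁,…,i_N) ∈ {1,2}^N: A(λ) B_{i₁}(λ₁)⋯B_{i_N}(λ_N) = B_{i₁}(λ₁)⋯B_{i_N}(λ_N) A(λ) ∏_{j=1}^N 1/a(λ_j−λ) − Σ_{j=1}^N Σ_{(m₁,…,m_N) ∈ {1,2}^N} B_{m₁}(λ) B_{m₂}(λ₁)⋯B_{m_j}(λ_{j−1}) B_{m_{j+1}}(λ_{j+1})⋯B_{m_N}(λ_N) · (S_{j−1})^{m₁⋯m_N}_{i₁⋯i_N}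 · A(λ_j) (b(λ_j−λ)/a(λ_j−λ)) ∏_{k≠j} 1/a(λ_k−λ_j). -/
noncomputable section

namespace Stmt10

/-- `a(λ) = λ/(λ+ic)`. -/
def fa (c lam : ℂ) : ℂ := lam / (lam + Complex.I * c)

/-- `b(λ) = ic/(λ+ic)`. -/
def fb (c lam : ℂ) : ℂ := Complex.I * c / (lam + Complex.I * c)

/-- The six-vertex matrix `ř(λ)` with entries
`ř^{ik}_{jl}(λ) = b(λ) δ^i_j δ^k_l − a(λ) δ^i_l δ^k_j`. -/
def rcheck (c lam : ℂ) : Matrix (Fin 2 × Fin 2) (Fin 2 × Fin 2) ℂ :=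
  fun x y =>
    fb c lam * (if x.1 = y.1 then 1 else 0) * (if x.2 = y.2 then 1 else 0)
      - fa c lam * (if x.1 = y.2 then 1 else 0) * (if x.2 = y.1 then 1 else 0)

/-- `ř(x)` acting on the factors `m`, `m'` of `(ℂ²)^{⊗N}`, as a matrix indexed by
multi-indices `Fin N → Fin 2` (row index first). -/
def rsite (c : ℂ) {N : ℕ} (m m' : Fin N) (x : ℂ) :
    Matrix (Fin N → Fin 2) (Fin N → Fin 2) ℂ :=
  fun v w =>
    rcheck c x (v m, v m') (w m, w m') *
      ∏ k ∈ (Finset.univ \ {m, m'}), (if v k = w k then 1 else 0)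

/-- The string `S_{j−1} = ř_{1,2}(λ₁−λ_j) ř_{2,3}(λ₂−λ_j) ⋯ ř_{j−1,j}(λ_{j−1}−λ_j)`
(paper's 1-based `j` corresponds to the 0-based index `j : Fin N` here; in
particular the paper's `S₀ = id` is the empty product below). -/
def Smat (c : ℂ) {N : ℕ} (lamj : Fin N → ℂ) (j : Fin N) :
    Matrix (Fin N → Fin 2) (Fin N → Fin 2) ℂ :=
  (List.ofFn fun m : Fin j.val =>
    rsite c (⟨m.val, by have := m.isLt; have := j.isLt; omega⟩ : Fin N)
            (⟨m.val + 1, by have := m.isLt; have := j.isLt; omega⟩ : Fin N)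
            (lamj ⟨m.val, by have := m.isLt; have := j.isLt; omega⟩ - lamj j)).prod

/-- Position (0-based) in the sequence `(λ, λ₁, …, λ_{j−1}, λ_{j+1}, …, λ_N)` of
the spectral parameter `λ_k`, `k ≠ j`:  `λ_k` sits at slot `k+1` if `k < j` and
at slot `k` if `k > j`. -/
def posIdx {N : ℕ} (j k : Fin N) : Fin N :=
  if h : k.val < j.val then ⟨k.val + 1, by have := j.isLt; omega⟩ else k

section helpers

variable {E : Type*} [AddCommGroup E] [Module ℂ E]

/-- Right action of a matrix on families of vectors indexed by its row indices. -/
def rowAct {ι : Type*} [Fintype ι] (f : ι → E) (M : Matrix ι ι ℂ) (i : ι) : E :=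
  ∑ m, M m i • f m

lemma rowAct_one {ι : Type*} [Fintype ι] [DecidableEq ι] (f : ι → E) :
    rowAct f (1 : Matrix ι ι ℂ) = f := by
  funext i
  simp [rowAct, Matrix.one_apply]

lemma rowAct_mul {ι : Type*} [Fintype ι] (f : ι → E) (M M' : Matrix ι ι ℂ) :
    rowAct f (M * M') = rowAct (rowAct f M) M' := by
  funext i
  simp only [rowAct, Matrix.mul_apply, Finset.sum_smul, Finset.smul_sum, smul_smul]
  rw [Finset.sum_comm]
  simp only [mul_comm]

lemma rsite_apply (c : ℂ) {N : ℕ} (m m' : Fin N) (x : ℂ) (v w : Fin N → Fin 2) :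
    rsite c m m' x v w =
      fb c x * (if v = w then 1 else 0) - fa c x * (if v = w ∘ Equiv.swap m m' then 1 else 0) := by
  have h1 : (v = w) ↔ (v m = w m ∧ v m' = w m') ∧
      ∀ k ∈ Finset.univ \ {m, m'}, v k = w k := by
    constructor
    · rintro rfl
      simp
    · rintro ⟨⟨h1, h2⟩, h3⟩
      funext k
      by_cases hk : k = m
      · rw [hk, h1]
      by_cases hk' : k = m'
      · rw [hk', h2]
      exact h3 k (by simp [hk, hk'])
  have h2 : (v = w ∘ Equiv.swap m m') ↔ (v m = w m' ∧ v m' = w m) ∧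
      ∀ k ∈ Finset.univ \ {m, m'}, v k = w k := by
    constructor
    · rintro rfl
      refine ⟨by simp, fun k hk => ?_⟩
      simp only [Finset.mem_sdiff, Finset.mem_univ, Finset.mem_insert, Finset.mem_singleton,
        true_and, not_or] at hk
      simp [Equiv.swap_apply_of_ne_of_ne hk.1 hk.2]
    · rintro ⟨⟨h1, h2⟩, h3⟩
      funext k
      by_cases hk : k = m
      · simp [hk, h1]
      by_cases hk' : k = m'
      · simp [hk', h2]
      simpa [Equiv.swap_apply_of_ne_of_ne hk hk'] using h3 k (by simp [hk, hk'])
  have h3 : ∏ k ∈ Finset.univ \ {m, m'}, (if v k = w k then (1 : ℂ) else 0) =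
      if ∀ k ∈ Finset.univ \ {m, m'}, v k = w k then 1 else 0 := Finset.prod_ite_zero.trans (by simp)
  rw [rsite, rcheck, h3]
  simp only [h1, h2, ite_and]
  split_ifs <;> ring

lemma rowAct_rsite (c : ℂ) {N : ℕ} (m m' : Fin N) (x : ℂ)
    (f : (Fin N → Fin 2) → E) (u : Fin N → Fin 2) :
    rowAct f (rsite c m m' x) u = fb c x • f u - fa c x • f (u ∘ Equiv.swap m m') := by
  simp [rowAct, rsite_apply, sub_smul, Finset.sum_sub_distrib]

lemma rowAct_rsite_succ (c : ℂ) {N : ℕ} (m m' : Fin N) (x : ℂ)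
    (f : (Fin (N + 1) → Fin 2) → E) (a : Fin 2) (u : Fin N → Fin 2) :
    rowAct f (rsite c m.succ m'.succ x) (Fin.cons a u) =
      rowAct (fun v => f (Fin.cons a v)) (rsite c m m' x) u := by
  rw [rowAct_rsite, rowAct_rsite]
  congr 3
  funext k
  refine Fin.cases ?_ (fun k => ?_) k
  · simp [Equiv.swap_apply_of_ne_of_ne, (Fin.succ_ne_zero _).symm]
  · simp only [Function.comp_apply, Fin.cons_succ]
    rw [(Fin.succ_injective N).swap_apply, Fin.cons_succ]

lemma rowAct_list_prod_succ (c : ℂ) {N : ℕ} (a : Fin 2) (l : List (Fin N × Fin N × ℂ))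
    (f : (Fin (N + 1) → Fin 2) → E) (u : Fin N → Fin 2) :
    rowAct f (l.map fun t => rsite c t.1.succ t.2.1.succ t.2.2).prod (Fin.cons a u) =
      rowAct (fun v => f (Fin.cons a v)) (l.map fun t => rsite c t.1 t.2.1 t.2.2).prod u := by
  induction l generalizing f with
  | nil => simp [rowAct_one]
  | cons t l ih =>
    simp only [List.map_cons, List.prod_cons, rowAct_mul]
    rw [ih]
    congr 1
    funext v
    exact rowAct_rsite_succ c _ _ _ f a v

lemma rowAct_Smat_zero (c : ℂ) {N : ℕ} (mu : Fin (N + 1) → ℂ) (f : (Fin (N + 1) → Fin 2) → E) :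
    rowAct f (Smat c mu 0) = f := by
  simp [Smat, rowAct_one]

lemma rowAct_Smat_succ (c : ℂ) {N : ℕ} (mu : Fin (N + 2) → ℂ) (j : Fin (N + 1))
    (f : (Fin (N + 2) → Fin 2) → E) (a : Fin 2) (u : Fin (N + 1) → Fin 2) :
    rowAct f (Smat c mu j.succ) (Fin.cons a u) =
      rowAct (fun v => fb c (mu 0 - mu j.succ) • f (Fin.cons a v) -
        fa c (mu 0 - mu j.succ) • f (Fin.cons (v 0) (Fin.cons a (Fin.tail v))))
        (Smat c (Fin.tail mu) j) u := by
  let l : List (Fin (N + 1) × Fin (N + 1) × ℂ) := List.ofFn fun m : Fin j.val =>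
    (⟨m.val, by have := m.isLt; have := j.isLt; omega⟩,
      ⟨m.val + 1, by have := m.isLt; have := j.isLt; omega⟩,
      mu ⟨m.val + 1, by have := m.isLt; have := j.isLt; omega⟩ - mu j.succ)
  have h1 : Smat c mu j.succ = rsite c 0 1 (mu 0 - mu j.succ) *
      (l.map fun t => rsite c t.1.succ t.2.1.succ t.2.2).prod := by
    unfold Smat
    simp only [l, List.map_ofFn]
    exact (congrArg List.prod List.ofFn_succ).trans List.prod_cons
  have h2 : Smat c (Fin.tail mu) j = (l.map fun t => rsite c t.1 t.2.1 t.2.2).prod := by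
    simp only [l, List.map_ofFn]
    rfl
  rw [h1, h2, rowAct_mul, rowAct_list_prod_succ]
  congr 1
  funext v
  rw [rowAct_rsite]
  congr 3
  funext k
  refine Fin.cases (by simp) (fun k => Fin.cases (by simp) (fun k => ?_) k) k
  simp only [Function.comp_apply, Fin.cons_succ]
  rw [Equiv.swap_apply_of_ne_of_ne (by simp) (by simp [Fin.ext_iff])]
  rfl

lemma rowAct_smul {ι : Type*} [Fintype ι] (x : ℂ) (f : ι → E) (M : Matrix ι ι ℂ) (i : ι) :
    rowAct (fun m => x • f m) M i = x • rowAct f M i := by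
  simp only [rowAct, Finset.smul_sum, smul_comm x]

lemma rowAct_sub {ι : Type*} [Fintype ι] (f g : ι → E) (M : Matrix ι ι ℂ) (i : ι) :
    rowAct (fun m => f m - g m) M i = rowAct f M i - rowAct g M i := by
  simp only [rowAct, smul_sub, Finset.sum_sub_distrib]

lemma mul_rowAct {R : Type*} [Ring R] [Algebra ℂ R] {ι : Type*} [Fintype ι] (x : R) (f : ι → R)
    (M : Matrix ι ι ℂ) (i : ι) : x * rowAct f M i = rowAct (fun m => x * f m) M i := by
  simp only [rowAct, Finset.mul_sum, mul_smul_comm]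

end helpers

section words

variable {R : Type*} [Ring R] (B : Fin 2 → ℂ → R)

/-- The product of the `B (m (posIdx j k)) (mu k)` over `k ≠ j`, in increasing order of `k`. -/
def deletedWord {N : ℕ} (mu : Fin N → ℂ) (j : Fin N) (m : Fin N → Fin 2) : R :=
  (List.ofFn fun k : Fin N => if k = j then 1 else B (m (posIdx j k)) (mu k)).prod

lemma deletedWord_zero {N : ℕ} (mu : Fin (N + 1) → ℂ) (m : Fin (N + 1) → Fin 2) :
    deletedWord B mu 0 m = (List.ofFn fun k => B (Fin.tail m k) (Fin.tail mu k)).prod := by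
  simp [deletedWord, List.ofFn_succ, posIdx, Fin.tail]

lemma deletedWord_succ {N : ℕ} (mu : Fin (N + 2) → ℂ) (j : Fin (N + 1)) (m : Fin (N + 2) → Fin 2) :
    deletedWord B mu j.succ m =
      B (m 1) (mu 0) * deletedWord B (Fin.tail mu) j (Fin.tail m) := by
  have h (k : Fin (N + 1)) : posIdx j.succ k.succ = (posIdx j k).succ := by
    simp only [posIdx, Fin.val_succ, add_lt_add_iff_right]
    split_ifs <;> rfl
  have h0 : posIdx j.succ 0 = 1 := by
    simp [posIdx]
  unfold deletedWord
  rw [List.ofFn_succ, List.prod_cons]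
  simp only [Fin.succ_inj, h, h0, (Fin.succ_ne_zero j).symm, if_false]
  rfl

lemma deletedWord_congr {N : ℕ} (mu : Fin (N + 1) → ℂ) (j : Fin (N + 1))
    {m m' : Fin (N + 1) → Fin 2} (h : Fin.tail m = Fin.tail m') :
    deletedWord B mu j m = deletedWord B mu j m' := by
  unfold deletedWord
  congr 2
  funext k
  split_ifs with hk
  · rfl
  · have : posIdx j k ≠ 0 := by
      unfold posIdx
      split_ifs with h'
      · exact fun h0 => Nat.succ_ne_zero _ (congrArg Fin.val h0)
      · rintro rfl
        exact hk (Fin.ext (Nat.le_zero.1 (not_lt.1 h')).symm)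
    obtain ⟨p, hp⟩ := Fin.exists_succ_eq.2 this
    rw [← hp]
    exact congrArg (fun q => B q (mu k)) (congrFun h p)

end words

lemma prod_erase_zero {N : ℕ} (g : Fin (N + 1) → ℂ) :
    ∏ k ∈ Finset.univ.erase 0, g k = ∏ k : Fin N, g k.succ := by
  rw [← Fin.prod_Ioi_zero]
  congr 1
  ext k
  simp

lemma prod_erase_succ {N : ℕ} (g : Fin (N + 1) → ℂ) (j : Fin N) :
    ∏ k ∈ Finset.univ.erase j.succ, g k = g 0 * ∏ k ∈ Finset.univ.erase j, g k.succ := by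
  have h : (Finset.univ.erase j.succ : Finset (Fin (N + 1))) =
      insert 0 ((Finset.univ.erase j).map (Fin.succEmb N)) := by
    ext k
    refine Fin.cases ?_ (fun k => ?_) k <;> simp [(Fin.succ_ne_zero _).symm]
  rw [h, Finset.prod_insert (by simp), Finset.prod_map]
  rfl

lemma fb_div_fa {c x : ℂ} (h : x + Complex.I * c ≠ 0) : fb c x / fa c x = Complex.I * c / x := by
  rw [fb, fa, div_div_div_cancel_right₀ h]

/-- The exchange step: passing `A` through one more factor on the left of a product turns the
coefficients of the shorter products into the one given by `ř`. -/
lemma exchange_identity {R : Type*} [Ring R] [Algebra ℂ R] (B : Fin 2 → ℂ → R) {c x y z : ℂ}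
    (hxy : x ≠ y) (hxz : x ≠ z) (hyz : y ≠ z)
    (hyx' : y - x + Complex.I * c ≠ 0) (hzx' : z - x + Complex.I * c ≠ 0)
    (hzy' : z - y + Complex.I * c ≠ 0) (hyz' : y - z + Complex.I * c ≠ 0) {i k : Fin 2}
    (hB : B i y * B k x = fb c (y - x) • (B i x * B k y) - fa c (y - x) • (B k x * B i y)) :
    (1 / fa c (y - x) * (fb c (z - x) / fa c (z - x))) • (B i y * B k x) -
        (fb c (y - x) / fa c (y - x) * (fb c (z - y) / fa c (z - y))) • (B i x * B k y) =
      (fb c (z - x) / fa c (z - x) * (1 / fa c (y - z))) •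
        (fb c (y - z) • (B i x * B k y) - fa c (y - z) • (B k x * B i y)) := by
  have h1 : y - x ≠ 0 := sub_ne_zero.2 hxy.symm
  have h2 : z - x ≠ 0 := sub_ne_zero.2 hxz.symm
  have h3 : z - y ≠ 0 := sub_ne_zero.2 hyz.symm
  have h4 : y - z ≠ 0 := sub_ne_zero.2 hyz
  rw [hB, fb_div_fa hyx', fb_div_fa hzx', fb_div_fa hzy']
  simp only [smul_sub, smul_smul]
  have e1 : 1 / fa c (y - x) * (Complex.I * c / (z - x)) * fa c (y - x) =
      Complex.I * c / (z - x) := by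
    have : fa c (y - x) ≠ 0 := div_ne_zero h1 hyx'
    field_simp
  have e2 : Complex.I * c / (z - x) * (1 / fa c (y - z)) * fa c (y - z) =
      Complex.I * c / (z - x) := by
    have : fa c (y - z) ≠ 0 := div_ne_zero h4 hyz'
    field_simp
  have e3 : 1 / fa c (y - x) * (Complex.I * c / (z - x)) * fb c (y - x) -
      Complex.I * c / (y - x) * (Complex.I * c / (z - y)) =
      Complex.I * c / (z - x) * (1 / fa c (y - z)) * fb c (y - z) := by
    have e4 : 1 / fa c (y - x) * (Complex.I * c / (z - x)) * fb c (y - x) =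
        (Complex.I * c / (z - x)) * (fb c (y - x) / fa c (y - x)) := by ring
    have e5 : Complex.I * c / (z - x) * (1 / fa c (y - z)) * fb c (y - z) =
        (Complex.I * c / (z - x)) * (fb c (y - z) / fa c (y - z)) := by ring
    rw [e4, e5, fb_div_fa hyx', fb_div_fa hyz', ← neg_sub z y]
    field_simp
    ring
  rw [e1, e2, ← e3, sub_smul]
  abel

lemma mul_list_prod_eq {R : Type*} [Ring R] [Algebra ℂ R] (c : ℂ) (s : Set ℂ)
    (A : ℂ → R) (B : Fin 2 → ℂ → R)
    (hs : ∀ x ∈ s, ∀ y ∈ s, x ≠ y → x - y + Complex.I * c ≠ 0)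
    (hB : ∀ x ∈ s, ∀ y ∈ s, ∀ i k : Fin 2,
      B i x * B k y = fb c (x - y) • (B i y * B k x) - fa c (x - y) • (B k y * B i x))
    (hA : ∀ x ∈ s, ∀ y ∈ s, x ≠ y → ∀ i : Fin 2,
      A x * B i y = (-(fb c (y - x) / fa c (y - x))) • (B i x * A y)
        + (1 / fa c (y - x)) • (B i y * A x))
    (N : ℕ) (lam : ℂ) (mu : Fin N → ℂ) (hlam_mem : lam ∈ s) (hmu_mem : ∀ j, mu j ∈ s)
    (hinj : Function.Injective mu) (hlam : ∀ j, lam ≠ mu j) (i : Fin N → Fin 2) :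
    A lam * (List.ofFn fun j => B (i j) (mu j)).prod =
      (∏ j, (1 / fa c (mu j - lam))) • ((List.ofFn fun j => B (i j) (mu j)).prod * A lam) -
        ∑ j, (fb c (mu j - lam) / fa c (mu j - lam) *
            ∏ k ∈ Finset.univ.erase j, (1 / fa c (mu k - mu j))) •
          (rowAct (fun m => B (m ⟨0, j.pos⟩) lam * deletedWord B mu j m) (Smat c mu j) i *
            A (mu j)) := by
  induction N generalizing lam with
  | zero => simp
  | succ N ih =>
    obtain ⟨a, u, rfl⟩ : ∃ a u, i = Fin.cons a u := ⟨i 0, Fin.tail i, (Fin.cons_self_tail i).symm⟩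
    have hinj' : Function.Injective (Fin.tail mu) := hinj.comp (Fin.succ_injective N)
    have ih0 := ih (mu 0) (Fin.tail mu) (hmu_mem 0) (fun j => hmu_mem j.succ) hinj'
      (fun j h => (Fin.succ_ne_zero j).symm (hinj h)) u
    have ihl := ih lam (Fin.tail mu) hlam_mem (fun j => hmu_mem j.succ) hinj'
      (fun j => hlam j.succ) u
    have hstep (j : Fin N) :
        (fb c (mu j.succ - lam) / fa c (mu j.succ - lam) *
            ∏ k ∈ Finset.univ.erase j.succ, (1 / fa c (mu k - mu j.succ))) •
          rowAct (fun m => B (m 0) lam * deletedWord B mu j.succ m) (Smat c mu j.succ)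
            (Fin.cons a u : Fin (N + 1) → Fin 2) =
        (1 / fa c (mu 0 - lam)) • (fb c (mu j.succ - lam) / fa c (mu j.succ - lam) *
            ∏ k ∈ Finset.univ.erase j, (1 / fa c (mu k.succ - mu j.succ))) •
          (B a (mu 0) * rowAct (fun m => B (m ⟨0, j.pos⟩) lam * deletedWord B (Fin.tail mu) j m)
            (Smat c (Fin.tail mu) j) u) -
        (fb c (mu 0 - lam) / fa c (mu 0 - lam)) •
          (fb c (mu j.succ - mu 0) / fa c (mu j.succ - mu 0) *
            ∏ k ∈ Finset.univ.erase j, (1 / fa c (mu k.succ - mu j.succ))) •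
          (B a lam * rowAct (fun m => B (m ⟨0, j.pos⟩) (mu 0) * deletedWord B (Fin.tail mu) j m)
            (Smat c (Fin.tail mu) j) u) := by
      obtain ⟨n, rfl⟩ : ∃ n, N = n + 1 := ⟨N - 1, by have := j.pos; omega⟩
      rw [rowAct_Smat_succ, prod_erase_succ]
      simp only [mul_rowAct, ← rowAct_smul, ← rowAct_sub]
      congr 1
      funext v
      have hv : deletedWord B (Fin.tail mu) j
          (Fin.cons a (Fin.tail v) : Fin (n + 1) → Fin 2) =
          deletedWord B (Fin.tail mu) j v :=
        deletedWord_congr _ _ _ (Fin.tail_cons _ _)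
      have h0j : mu 0 ≠ mu j.succ := fun h => (Fin.succ_ne_zero j).symm (hinj h)
      have key := exchange_identity B (hlam 0) (hlam j.succ) h0j
        (hs _ (hmu_mem _) _ hlam_mem (hlam 0).symm)
        (hs _ (hmu_mem _) _ hlam_mem (hlam _).symm)
        (hs _ (hmu_mem _) _ (hmu_mem _) h0j.symm)
        (hs _ (hmu_mem _) _ (hmu_mem _) h0j)
        (hB _ (hmu_mem 0) _ hlam_mem a (v 0))
      have h1 : (Fin.cons a v : Fin (n + 2) → Fin 2) 1 = v 0 := rfl
      have h2 : (Fin.cons (v 0) (Fin.cons a (Fin.tail v) : Fin (n + 1) → Fin 2) :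
        Fin (n + 2) → Fin 2) 1 = a := rfl
      simp only [deletedWord_succ, hv, Fin.tail_cons, Fin.cons_zero, h1, h2]
      have key' := congrArg (fun w => (∏ k ∈ Finset.univ.erase j,
        (1 / fa c (mu k.succ - mu j.succ))) • (w * deletedWord B (Fin.tail mu) j v)) key
      simp only [sub_mul, smul_sub, smul_mul_assoc, smul_smul, mul_assoc] at key' ⊢
      have hz : (⟨0, j.pos⟩ : Fin (n + 1)) = 0 := rfl
      simp only [hz]
      convert key'.symm using 1 <;> congr 2 <;> ring
    rw [List.ofFn_succ, List.prod_cons, ← mul_assoc]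
    simp only [Fin.cons_zero, Fin.cons_succ]
    rw [hA lam hlam_mem (mu 0) (hmu_mem 0) (hlam 0) a, Fin.sum_univ_succ, Fin.prod_univ_succ,
      add_mul, smul_mul_assoc, smul_mul_assoc, mul_assoc, mul_assoc]
    simp only [Fin.tail] at ih0 ihl
    rw [ih0, ihl]
    have hsum (j : Fin N) := congrArg (· * A (mu j.succ)) (hstep j)
    simp only [smul_mul_assoc, sub_mul] at hsum
    have hzero : (⟨0, Nat.succ_pos N⟩ : Fin (N + 1)) = 0 := rfl
    simp only [hzero, hsum, rowAct_Smat_zero, deletedWord_zero, prod_erase_zero,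
      Finset.sum_sub_distrib, Fin.tail_cons, Fin.cons_zero]
    simp only [mul_sub, smul_sub, Finset.mul_sum, Finset.smul_sum, mul_smul_comm, mul_assoc,
      neg_mul, neg_smul, smul_smul, Finset.sum_neg_distrib, Fin.tail]
    abel

/-- Iterated commutation of `A` with a product of B-operators (equation (4.1) of
the paper), written componentwise for each multi-index `i : Fin N → Fin 2`. -/
theorem A_Bproduct_commutation {H : Type*} [AddCommGroup H] [Module ℂ H]
    (c : ℂ) (hc : c ≠ 0) (N : ℕ) (lam : ℂ) (lamj : Fin N → ℂ)
    (A : ℂ → Module.End ℂ H) (B : Fin 2 → ℂ → Module.End ℂ H)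
    (hinj : Function.Injective lamj) (hlam : ∀ j, lam ≠ lamj j)
    (hdiff : ∀ x ∈ insert lam (Set.range lamj), ∀ y ∈ insert lam (Set.range lamj),
      x ≠ y → x - y ≠ Complex.I * c ∧ x - y ≠ -(Complex.I * c))
    (hB : ∀ x ∈ insert lam (Set.range lamj), ∀ y ∈ insert lam (Set.range lamj),
      ∀ i k : Fin 2,
        B i x * B k y = fb c (x - y) • (B i y * B k x) - fa c (x - y) • (B k y * B i x))
    (hA : ∀ x ∈ insert lam (Set.range lamj), ∀ y ∈ insert lam (Set.range lamj),
      x ≠ y → ∀ i : Fin 2,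
        A x * B i y = (-(fb c (y - x) / fa c (y - x))) • (B i x * A y)
          + (1 / fa c (y - x)) • (B i y * A x)) :
    ∀ i : Fin N → Fin 2,
      A lam * (List.ofFn fun j => B (i j) (lamj j)).prod
      = (∏ j : Fin N, (1 / fa c (lamj j - lam))) •
          ((List.ofFn fun j => B (i j) (lamj j)).prod * A lam)
        - ∑ j : Fin N, ∑ m : Fin N → Fin 2,
            (Smat c lamj j m i * (fb c (lamj j - lam) / fa c (lamj j - lam)) *
                ∏ k ∈ Finset.univ.erase j, (1 / fa c (lamj k - lamj j))) •
              ((B (m ⟨0, lt_of_le_of_lt (Nat.zero_le _) j.isLt⟩) lam *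
                  (List.ofFn fun k : Fin N =>
                    if k = j then 1 else B (m (posIdx j k)) (lamj k)).prod) *
                A (lamj j)) := by
  intro i
  have hs : ∀ x ∈ insert lam (Set.range lamj), ∀ y ∈ insert lam (Set.range lamj),
      x ≠ y → x - y + Complex.I * c ≠ 0 := fun x hx y hy hxy h =>
    (hdiff x hx y hy hxy).2 (eq_neg_of_add_eq_zero_left h)
  rw [mul_list_prod_eq c (insert lam (Set.range lamj)) A B hs hB hA N lam lamj
    (Set.mem_insert _ _) (fun j => Set.mem_insert_of_mem _ ⟨j, rfl⟩) hinj hlam i]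
  congr 1
  refine Finset.sum_congr rfl fun j _ => ?_
  simp only [rowAct, Finset.sum_mul, Finset.smul_sum, smul_mul_assoc, smul_smul]
  refine Finset.sum_congr rfl fun m _ => ?_
  congr 1
  ring

end Stmt10
end
end

section
/- Iterated commutation of à with a product of B̃-operators in the gl(2) generalized model: let V be a complex vector space and Ã(ν), B̃(ν) ∈ End(V) for ν ∈ {λ, μ₁, …, μ_M}, these points pairwise distinct with all pairwise differences not in {ic, −ic}. Assume B̃(ν)B̃(ν') = B̃(ν')B̃(ν) and Ã(ν)B̃(ν') = −(b(ν−ν')/a(ν−ν')) B̃(ν)Ã(ν') + (1/a(ν−ν')) B̃(ν')Ã(ν) for all ν ≠ ν' among these points. Then Ã(λ) ∏_{k=1}^M B̃(μ_k) = [∏_{k=1}^M B̃(μ_k)] Ã(λ) ∏_{k=1}^M 1/a(λ−μ_k) − Σ_{k=1}^M B̃(λ) [∏_{l≠k} B̃(μ_l)] Ã(μ_k) (b(λ−μ_k)/a(λ−μ_k)) ∏_{l≠k} 1/a(μ_k−μ_l). -/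
noncomputable section

namespace Stmt11

/-- `a(λ) = λ/(λ+ic)`. -/
def fa (c lam : ℂ) : ℂ := lam / (lam + Complex.I * c)

/-- `b(λ) = ic/(λ+ic)`. -/
def fb (c lam : ℂ) : ℂ := Complex.I * c / (lam + Complex.I * c)

/-- Moving `A x` through an ordered product of commuting operators `B (y k)`, for an exchange
relation whose coefficients `f`, `h` satisfy a three-term identity. -/
theorem exchange_mul_prod_ofFn {K R ι : Type*} [Field K] [Ring R] [Algebra K R]
    {s : Set ι} {f h : ι → ι → K} {A B : ι → R}
    (hB : ∀ x ∈ s, ∀ y ∈ s, B x * B y = B y * B x)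
    (hA : ∀ x ∈ s, ∀ y ∈ s, x ≠ y →
      A x * B y = f x y • (B y * A x) - h x y • (B x * A y))
    (hfh : ∀ x ∈ s, ∀ y ∈ s, ∀ z ∈ s, x ≠ y → x ≠ z → y ≠ z →
      h x z * f z y = f x y * h x z - h x y * h y z)
    {M : ℕ} (x : ι) (hx : x ∈ s) (y : Fin M → ι) (hy : ∀ k, y k ∈ s)
    (hinj : Function.Injective y) (hxy : ∀ k, x ≠ y k) :
    A x * (List.ofFn fun k => B (y k)).prod
      = (∏ k, f x (y k)) • ((List.ofFn fun k => B (y k)).prod * A x)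
        - ∑ k, (h x (y k) * ∏ l, if l = k then 1 else f (y k) (y l)) •
            (B x * (List.ofFn fun l => if l = k then 1 else B (y l)).prod * A (y k)) := by
  induction M generalizing x with
  | zero => simp
  | succ M ih =>
    have hne (k : Fin M) : y 0 ≠ y k.succ := fun e => (Fin.succ_ne_zero k) (hinj e).symm
    have ih' (z : ι) (hz : z ∈ s) (hzy : ∀ k : Fin M, z ≠ y k.succ) :=
      ih z hz (fun k => y k.succ) (fun k => hy _)
        (hinj.comp (Fin.succ_injective M)) hzy
    have ihx := ih' x hx fun k => hxy _
    have ihy := ih' (y 0) (hy 0) hne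
    simp only [List.ofFn_succ, List.prod_cons, Fin.prod_univ_succ, Fin.sum_univ_succ,
      Fin.succ_ne_zero, (Fin.succ_ne_zero _).symm, Fin.succ_inj, if_true, if_false, one_mul]
    rw [← mul_assoc, hA x hx _ (hy 0) (hxy 0), sub_mul, smul_mul_assoc, smul_mul_assoc,
      mul_assoc, mul_assoc, ihx, ihy]
    simp only [mul_sub, smul_sub, Finset.mul_sum, Finset.smul_sum, mul_smul_comm, smul_smul,
      mul_assoc]
    rw [sub_sub]
    congr 1
    rw [add_sub_left_comm, ← Finset.sum_sub_distrib]
    congr 1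
    refine Finset.sum_congr rfl fun k _ => ?_
    rw [← mul_assoc (B (y 0)), hB _ (hy 0) _ hx, mul_assoc, ← sub_smul]
    congr 1
    linear_combination (-∏ l : Fin M, if l = k then 1 else f (y k.succ) (y l.succ)) *
      hfh x hx _ (hy 0) _ (hy k.succ) (hxy _) (hxy _) (hne k)

/-- Iterated commutation of `Ã` with a product of B̃-operators in the gl(2)
generalized model.  Products `∏_{k} B̃(μ_k)` are taken in the order `k = 1,…,M`;
the omission of the factor `l = k` is implemented by inserting the identity
operator at slot `l = k`. -/
theorem Atilde_Bproduct_commutation {V : Type*} [AddCommGroup V] [Module ℂ V]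
    (c : ℂ) (hc : c ≠ 0) (M : ℕ) (lam : ℂ) (mus : Fin M → ℂ)
    (At Bt : ℂ → Module.End ℂ V)
    (hinj : Function.Injective mus) (hlam : ∀ k, lam ≠ mus k)
    (hdiff : ∀ x ∈ insert lam (Set.range mus), ∀ y ∈ insert lam (Set.range mus),
      x ≠ y → x - y ≠ Complex.I * c ∧ x - y ≠ -(Complex.I * c))
    (hBB : ∀ x ∈ insert lam (Set.range mus), ∀ y ∈ insert lam (Set.range mus),
      Bt x * Bt y = Bt y * Bt x)
    (hAB : ∀ x ∈ insert lam (Set.range mus), ∀ y ∈ insert lam (Set.range mus),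
      x ≠ y →
        At x * Bt y = (-(fb c (x - y) / fa c (x - y))) • (Bt x * At y)
          + (1 / fa c (x - y)) • (Bt y * At x)) :
    At lam * (List.ofFn fun k => Bt (mus k)).prod
      = (∏ k : Fin M, (1 / fa c (lam - mus k))) •
          ((List.ofFn fun k => Bt (mus k)).prod * At lam)
        - ∑ k : Fin M,
            ((fb c (lam - mus k) / fa c (lam - mus k)) *
                ∏ l ∈ Finset.univ.erase k, (1 / fa c (mus k - mus l))) •
              (Bt lam *
                (List.ofFn fun l : Fin M => if l = k then 1 else Bt (mus l)).prod *
                At (mus k)) := by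
  have hlamm : lam ∈ insert lam (Set.range mus) := Set.mem_insert _ _
  have hmus (k : Fin M) : mus k ∈ insert lam (Set.range mus) := Set.mem_insert_of_mem _ ⟨k, rfl⟩
  have hb {x y : ℂ} (hx : x ∈ insert lam (Set.range mus))
      (hy : y ∈ insert lam (Set.range mus)) (hxy : x ≠ y) :
      fb c (x - y) / fa c (x - y) = Complex.I * c / (x - y) := by
    have hden : x - y + Complex.I * c ≠ 0 := fun e =>
      (hdiff x hx y hy hxy).2 (eq_neg_of_add_eq_zero_left e)
    rw [fb, fa, div_div_div_cancel_right₀ hden]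
  have key := exchange_mul_prod_ofFn (f := fun x y => 1 / fa c (x - y))
    (h := fun x y => fb c (x - y) / fa c (x - y)) (A := At) hBB
    (fun x hx y hy hxy => by rw [hAB x hx y hy hxy, neg_smul, neg_add_eq_sub])
    (fun x hx y hy z hz hxy hxz hyz => by
      have h1 := sub_ne_zero.2 hxy
      have h2 := sub_ne_zero.2 hxz
      have h3 := sub_ne_zero.2 hyz.symm
      simp only [hb hx hz hxz, hb hx hy hxy, hb hy hz hyz]
      rw [← neg_sub z y]
      simp only [fa, one_div_div]
      field_simp
      ring)
    lam hlamm mus hmus hinj hlam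
  rw [key]
  congr 1
  refine Finset.sum_congr rfl fun k _ => ?_
  congr 2
  rw [← Finset.mul_prod_erase _ _ (Finset.mem_univ k), if_pos rfl, one_mul]
  exact Finset.prod_congr rfl fun l hl => if_neg (Finset.ne_of_mem_erase hl)

end Stmt11
end
end

section
/- Iterated commutation of D̃ with a product of B̃-operators in the gl(2) generalized model: let V be a complex vector space and D̃(ν), B̃(ν) ∈ End(V) for ν ∈ {λ, μ₁, …, μ_M}, these points pairwise distinct with all pairwise differences not in {ic, −ic}. Assume B̃(ν)B̃(ν') = B̃(ν')B̃(ν) and D̃(ν)B̃(ν') = −(b(ν'−ν)/a(ν'−ν)) B̃(ν)D̃(ν') + (1/a(ν'−ν)) B̃(ν')D̃(ν) for all ν ≠ ν' among these points. Then D̃(λ) ∏_{k=1}^M B̃(μ_k) = [∏_{k=1}^M B̃(μ_k)] D̃(λ) ∏_{k=1}^M 1/a(μ_k−λ) − Σ_{k=1}^M B̃(λ) [∏_{l≠k} B̃(μ_l)] D̃(μ_k) (b(μ_k−λ)/a(μ_k−λ)) ∏_{l≠k} 1/a(μ_l−μ_k). -/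
noncomputable section

namespace Stmt12

/-- `a(λ) = λ/(λ+ic)`. -/
def fa (c lam : ℂ) : ℂ := lam / (lam + Complex.I * c)

/-- `b(λ) = ic/(λ+ic)`. -/
def fb (c lam : ℂ) : ℂ := Complex.I * c / (lam + Complex.I * c)

/-- Products over all indices but one, written with the omitted factor replaced by `1`. -/
theorem prod_univ_erase_eq_prod_ite {K ι : Type*} [CommMonoid K] [Fintype ι] [DecidableEq ι]
    (k : ι) (h : ι → K) :
    ∏ l ∈ Finset.univ.erase k, h l = ∏ l, if l = k then 1 else h l := by
  rw [← Finset.mul_prod_erase Finset.univ _ (Finset.mem_univ k), if_pos rfl, one_mul]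
  exact Finset.prod_congr rfl fun l hl => (if_neg (Finset.ne_of_mem_erase hl)).symm

/-- Moving `D x` through an ordered product of `B`'s, for abstract exchange coefficients `F`, `G`
satisfying the three-term relation `hFG`. -/
theorem mul_prod_ofFn_of_exchange {K A ι : Type*} [CommRing K] [Ring A] [Algebra K A]
    (S : Set ι) (D B : ι → A) (F G : ι → ι → K)
    (hBB : ∀ x ∈ S, ∀ y ∈ S, B x * B y = B y * B x)
    (hDB : ∀ x ∈ S, ∀ y ∈ S, x ≠ y →
      D x * B y = (-G x y) • (B x * D y) + F x y • (B y * D x))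
    (hFG : ∀ x ∈ S, ∀ y ∈ S, ∀ z ∈ S, x ≠ y → x ≠ z → y ≠ z →
      F x y * G x z - G x y * G y z = G x z * F z y)
    (M : ℕ) (x : ι) (hx : x ∈ S) (m : Fin M → ι) (hm : ∀ k, m k ∈ S)
    (hinj : Function.Injective m) (hxm : ∀ k, x ≠ m k) :
    D x * (List.ofFn fun k => B (m k)).prod
      = (∏ k, F x (m k)) • ((List.ofFn fun k => B (m k)).prod * D x)
        - ∑ k, (G x (m k) * ∏ l, if l = k then 1 else F (m k) (m l)) •
            (B x * (List.ofFn fun l => if l = k then 1 else B (m l)).prod * D (m k)) := by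
  induction M generalizing x with
  | zero => simp
  | succ n ih =>
    have hinj' : Function.Injective fun k : Fin n => m k.succ :=
      hinj.comp (Fin.succ_injective n)
    have h0 : ∀ k : Fin n, m 0 ≠ m k.succ := fun k h => (Fin.succ_ne_zero k).symm (hinj h)
    have ih₀ := ih (m 0) (hm 0) (fun k => m k.succ) (fun k => hm _) hinj' h0
    have ihx := ih x hx (fun k => m k.succ) (fun k => hm _) hinj' fun k => hxm _
    simp only [List.ofFn_succ, List.prod_cons, Fin.sum_univ_succ, Fin.prod_univ_succ,
      Fin.succ_ne_zero, (Fin.succ_ne_zero _).symm, Fin.succ_inj, if_true, if_false, one_mul]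
    generalize (List.ofFn fun k : Fin n => B (m k.succ)).prod = P at *
    have hsum : ∑ k : Fin n, (G x (m k.succ) *
          (F (m k.succ) (m 0) * ∏ l : Fin n, if l = k then 1 else F (m k.succ) (m l.succ))) •
            (B x * (B (m 0) * (List.ofFn fun l : Fin n =>
              if l = k then 1 else B (m l.succ)).prod) * D (m k.succ))
        = F x (m 0) • (B (m 0) * ∑ k : Fin n, (G x (m k.succ) *
            ∏ l : Fin n, if l = k then 1 else F (m k.succ) (m l.succ)) •
            (B x * (List.ofFn fun l : Fin n =>
              if l = k then 1 else B (m l.succ)).prod * D (m k.succ)))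
          - G x (m 0) • (B x * ∑ k : Fin n, (G (m 0) (m k.succ) *
            ∏ l : Fin n, if l = k then 1 else F (m k.succ) (m l.succ)) •
            (B (m 0) * (List.ofFn fun l : Fin n =>
              if l = k then 1 else B (m l.succ)).prod * D (m k.succ))) := by
      simp only [Finset.mul_sum, Finset.smul_sum, ← Finset.sum_sub_distrib]
      refine Finset.sum_congr rfl fun k _ => ?_
      simp only [mul_smul_comm, smul_smul, ← mul_assoc]
      rw [hBB (m 0) (hm 0) x hx, ← sub_smul,
        ← hFG x hx (m 0) (hm 0) (m k.succ) (hm _) (hxm 0) (hxm _) (h0 k)]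
      congr 1
      ring
    rw [hsum, ← mul_assoc, hDB x hx (m 0) (hm 0) (hxm 0), add_mul, smul_mul_assoc,
      smul_mul_assoc, mul_assoc, mul_assoc, ih₀, ihx]
    simp only [mul_sub, smul_sub, mul_smul_comm, smul_smul, neg_mul, neg_smul, mul_assoc]
    abel

/-- Iterated commutation of `D̃` with a product of B̃-operators in the gl(2)
generalized model.  Products `∏_{k} B̃(μ_k)` are taken in the order `k = 1,…,M`;
the omission of the factor `l = k` is implemented by inserting the identity
operator at slot `l = k`. -/
theorem Dtilde_Bproduct_commutation {V : Type*} [AddCommGroup V] [Module ℂ V]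
    (c : ℂ) (hc : c ≠ 0) (M : ℕ) (lam : ℂ) (mus : Fin M → ℂ)
    (Dt Bt : ℂ → Module.End ℂ V)
    (hinj : Function.Injective mus) (hlam : ∀ k, lam ≠ mus k)
    (hdiff : ∀ x ∈ insert lam (Set.range mus), ∀ y ∈ insert lam (Set.range mus),
      x ≠ y → x - y ≠ Complex.I * c ∧ x - y ≠ -(Complex.I * c))
    (hBB : ∀ x ∈ insert lam (Set.range mus), ∀ y ∈ insert lam (Set.range mus),
      Bt x * Bt y = Bt y * Bt x)
    (hDB : ∀ x ∈ insert lam (Set.range mus), ∀ y ∈ insert lam (Set.range mus),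
      x ≠ y →
        Dt x * Bt y = (-(fb c (y - x) / fa c (y - x))) • (Bt x * Dt y)
          + (1 / fa c (y - x)) • (Bt y * Dt x)) :
    Dt lam * (List.ofFn fun k => Bt (mus k)).prod
      = (∏ k : Fin M, (1 / fa c (mus k - lam))) •
          ((List.ofFn fun k => Bt (mus k)).prod * Dt lam)
        - ∑ k : Fin M,
            ((fb c (mus k - lam) / fa c (mus k - lam)) *
                ∏ l ∈ Finset.univ.erase k, (1 / fa c (mus l - mus k))) •
              (Bt lam *
                (List.ofFn fun l : Fin M => if l = k then 1 else Bt (mus l)).prod *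
                Dt (mus k)) := by
  simp only [prod_univ_erase_eq_prod_ite]
  refine mul_prod_ofFn_of_exchange (insert lam (Set.range mus)) Dt Bt
    (fun x y => 1 / fa c (y - x)) (fun x y => fb c (y - x) / fa c (y - x)) hBB hDB ?_
    M lam (Set.mem_insert _ _) mus (fun k => Set.mem_insert_of_mem _ ⟨k, rfl⟩) hinj hlam
  intro x hx y hy z hz hxy hxz hyz
  have shift_ne : ∀ u ∈ insert lam (Set.range mus), ∀ v ∈ insert lam (Set.range mus),
      u ≠ v → v - u + Complex.I * c ≠ 0 := fun u hu v hv huv h =>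
    (hdiff v hv u hu huv.symm).2 (eq_neg_of_add_eq_zero_left h)
  have h₁ := shift_ne x hx y hy hxy
  have h₂ := shift_ne x hx z hz hxz
  have h₃ := shift_ne y hy z hz hyz
  have d₁ := sub_ne_zero.2 hxy.symm
  have d₂ := sub_ne_zero.2 hxz.symm
  have d₃ := sub_ne_zero.2 hyz.symm
  simp only [fa, fb, one_div_div, div_div_div_cancel_right₀ h₁, div_div_div_cancel_right₀ h₂,
    div_div_div_cancel_right₀ h₃]
  field_simp
  ring

end Stmt12
end
end

section
/- Algebraic Bethe ansatz for the gl(2) generalized model (second-level Bethe ansatz): let V be a complex vector space and Ã(ν), B̃(ν), D̃(ν) ∈ End(V) for ν ∈ {λ, μ₁, …, μ_M}, these points pairwise distinct with all pairwise differences not in {ic, −ic}. Assume for all ν ≠ ν' among these points: B̃(ν)B̃(ν') = B̃(ν')B̃(ν), Ã(ν)B̃(ν') = −(b(ν−ν')/a(ν−ν')) B̃(ν)Ã(ν') + (1/a(ν−ν')) B̃(ν')Ã(ν), and D̃(ν)B̃(ν') = −(b(ν'−ν)/a(ν'−ν)) B̃(ν)D̃(ν') + (1/a(ν'−ν)) B̃(ν')D̃(ν).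 Suppose Ω̂ ∈ V and complex numbers α(ν), δ(ν) satisfy Ã(ν)Ω̂ = α(ν)Ω̂ and D̃(ν)Ω̂ = δ(ν)Ω̂ for all these ν, and that the Bethe ansatz equations α(μ_k) ∏_{l≠k} a(μ_l−μ_k)/a(μ_k−μ_l) = δ(μ_k) hold for k = 1,…,M. Then (Ã(λ) + D̃(λ)) B̃(μ₁)⋯B̃(μ_M) Ω̂ = Λ̃(λ) B̃(μ₁)⋯B̃(μ_M) Ω̂, where Λ̃(λ) = α(λ) ∏_{k=1}^M 1/a(λ−μ_k) + δ(λ) ∏_{k=1}^M 1/a(μ_k−λ). (In the paper, specializing α(ν) = (−1)^N a₂(ν) ∏_{j=1}^N a(ν−λ_j)/a(λ_j−ν) and δ(ν) = (−1)^N a₃(ν) ∏_{j=1}^N a(ν−λ_j) yields equations (4.45)–(4.47).) -/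
noncomputable section

namespace Stmt13

/-- `a(λ) = λ/(λ+ic)`. -/
def fa (c lam : ℂ) : ℂ := lam / (lam + Complex.I * c)

/-- `b(λ) = ic/(λ+ic)`. -/
def fb (c lam : ℂ) : ℂ := Complex.I * c / (lam + Complex.I * c)

lemma one_div_fa {c u : ℂ} (hu : u ≠ 0) (hu' : u + Complex.I * c ≠ 0) :
    1 / fa c u = 1 + Complex.I * c / u := by
  unfold fa
  field_simp

lemma fb_div_fa {c u : ℂ} (hu' : u + Complex.I * c ≠ 0) :
    fb c u / fa c u = Complex.I * c / u :=
  div_div_div_cancel_right₀ hu' _ _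

/-- The product of the creation operators `B y`, `y ∈ s`, applied to `Ω`. -/
def betheVector {V : Type*} [AddCommGroup V] [Module ℂ V]
    (B : ℂ → Module.End ℂ V) (Ω : V) (s : Finset ℂ) : V :=
  (s.toList.map B).prod Ω

section BetheVector

variable {V : Type*} [AddCommGroup V] [Module ℂ V] {B : ℂ → Module.End ℂ V} {Ω : V} {S : Set ℂ}

lemma betheVector_eq_of_perm (hB : ∀ x ∈ S, ∀ y ∈ S, B x * B y = B y * B x)
    {s : Finset ℂ} (hs : ↑s ⊆ S) {l : List ℂ} (hl : s.toList.Perm l) :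
    betheVector B Ω s = (l.map B).prod Ω := by
  unfold betheVector
  rw [(hl.map B).prod_eq']
  refine List.Pairwise.map _ (fun _ _ h => h) (List.pairwise_of_forall_mem_list ?_)
  intro x hx y hy
  exact hB x (hs (by simpa using hx)) y (hs (by simpa using hy))

lemma betheVector_insert (hB : ∀ x ∈ S, ∀ y ∈ S, B x * B y = B y * B x)
    {s : Finset ℂ} {y : ℂ} (hs : ↑(insert y s) ⊆ S) (hy : y ∉ s) :
    betheVector B Ω (insert y s) = B y (betheVector B Ω s) := by
  rw [betheVector_eq_of_perm hB hs (Finset.toList_insert hy)]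
  simp [betheVector]

/-- Action of a diagonal operator `X x` on a Bethe vector, for the exchange relation with
parameter `η`: one wanted term, and one unwanted term for each spectral parameter. -/
lemma exchange_apply_betheVector (hB : ∀ x ∈ S, ∀ y ∈ S, B x * B y = B y * B x)
    {X : ℂ → Module.End ℂ V} {χ : ℂ → ℂ} {η : ℂ}
    (hX : ∀ x ∈ S, ∀ y ∈ S, x ≠ y →
      X x * B y = (-(η / (x - y))) • (B x * X y) + (1 + η / (x - y)) • (B y * X x))
    (hΩ : ∀ x ∈ S, X x Ω = χ x • Ω) (s : Finset ℂ) :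
    ↑s ⊆ S → ∀ x ∈ S, x ∉ s →
      X x (betheVector B Ω s) = (χ x * ∏ y ∈ s, (1 + η / (x - y))) • betheVector B Ω s
        + ∑ k ∈ s, (-(η / (x - k)) * (χ k * ∏ l ∈ s.erase k, (1 + η / (k - l)))) •
            B x (betheVector B Ω (s.erase k)) := by
  induction s using Finset.induction_on with
  | empty =>
    intro _ x hx _
    simp [betheVector, hΩ x hx]
  | insert y s hy ih =>
    intro hs x hx hxs
    have hyS : y ∈ S := hs (by simp)
    have hsS : ↑s ⊆ S := fun z hz => hs (by simpa using Or.inr hz)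
    have hxy : x ≠ y := fun h => hxs (by simp [h])
    have hxs' : x ∉ s := fun h => hxs (by simp [h])
    have unwanted : ∀ k ∈ s,
        (-(η / (x - k)) * (χ k * ∏ l ∈ (insert y s).erase k, (1 + η / (k - l)))) •
            B x (betheVector B Ω ((insert y s).erase k))
          = (-(η / (x - y))) • B x ((-(η / (y - k)) *
              (χ k * ∏ l ∈ s.erase k, (1 + η / (k - l)))) • B y (betheVector B Ω (s.erase k)))
            + (1 + η / (x - y)) • B y ((-(η / (x - k)) *
              (χ k * ∏ l ∈ s.erase k, (1 + η / (k - l)))) •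
                B x (betheVector B Ω (s.erase k))) := by
      intro k hk
      have hyk : y ≠ k := fun h => hy (h ▸ hk)
      have hxk : x ≠ k := fun h => hxs' (h ▸ hk)
      have hye : y ∉ s.erase k := fun h => hy (Finset.mem_of_mem_erase h)
      have hcomm : B y (B x (betheVector B Ω (s.erase k)))
          = B x (B y (betheVector B Ω (s.erase k))) :=
        LinearMap.congr_fun (hB y hyS x hx) _
      have hsub : ↑(insert y (s.erase k)) ⊆ S := fun z hz => hs <|
        Finset.insert_subset_insert y (Finset.erase_subset k s) hz
      rw [Finset.erase_insert_of_ne hyk, Finset.prod_insert hye, betheVector_insert hB hsub hye]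
      simp only [map_smul, hcomm, smul_smul, ← add_smul]
      congr 1
      have h₁ : x - y ≠ 0 := sub_ne_zero.2 hxy
      have h₂ : y - k ≠ 0 := sub_ne_zero.2 hyk
      have h₃ : x - k ≠ 0 := sub_ne_zero.2 hxk
      have h₄ : k - y ≠ 0 := sub_ne_zero.2 hyk.symm
      field_simp
      ring
    have hXB : X x (B y (betheVector B Ω s))
        = (-(η / (x - y))) • B x (X y (betheVector B Ω s))
          + (1 + η / (x - y)) • B y (X x (betheVector B Ω s)) :=
      LinearMap.congr_fun (hX x hx y hyS hxy) _
    rw [Finset.sum_insert hy, Finset.sum_congr rfl unwanted, Finset.sum_add_distrib,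
      Finset.erase_insert hy, Finset.prod_insert hy, betheVector_insert hB hs hy, hXB,
      ih hsS x hx hxs', ih hsS y hyS hy]
    simp only [map_add, map_sum, smul_add, Finset.smul_sum]
    simp only [map_smul, smul_smul]
    module

end BetheVector

/-- Algebraic Bethe ansatz for the gl(2) generalized model (second-level Bethe
ansatz): if the Bethe ansatz equations
`α(μ_k) ∏_{l≠k} a(μ_l−μ_k)/a(μ_k−μ_l) = δ(μ_k)` hold, then
`B̃(μ₁)⋯B̃(μ_M) Ω̂` is an eigenvector of `Ã(λ) + D̃(λ)` with eigenvalue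
`Λ̃(λ) = α(λ) ∏_k 1/a(λ−μ_k) + δ(λ) ∏_k 1/a(μ_k−λ)`. -/
theorem gl2_algebraic_bethe_ansatz {V : Type*} [AddCommGroup V] [Module ℂ V]
    (c : ℂ) (hc : c ≠ 0) (M : ℕ) (lam : ℂ) (mus : Fin M → ℂ)
    (At Bt Dt : ℂ → Module.End ℂ V)
    (hinj : Function.Injective mus) (hlam : ∀ k, lam ≠ mus k)
    (hdiff : ∀ x ∈ insert lam (Set.range mus), ∀ y ∈ insert lam (Set.range mus),
      x ≠ y → x - y ≠ Complex.I * c ∧ x - y ≠ -(Complex.I * c))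
    (hBB : ∀ x ∈ insert lam (Set.range mus), ∀ y ∈ insert lam (Set.range mus),
      Bt x * Bt y = Bt y * Bt x)
    (hAB : ∀ x ∈ insert lam (Set.range mus), ∀ y ∈ insert lam (Set.range mus),
      x ≠ y →
        At x * Bt y = (-(fb c (x - y) / fa c (x - y))) • (Bt x * At y)
          + (1 / fa c (x - y)) • (Bt y * At x))
    (hDB : ∀ x ∈ insert lam (Set.range mus), ∀ y ∈ insert lam (Set.range mus),
      x ≠ y →
        Dt x * Bt y = (-(fb c (y - x) / fa c (y - x))) • (Bt x * Dt y)
          + (1 / fa c (y - x)) • (Bt y * Dt x))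
    (Ωhat : V) (α δ : ℂ → ℂ)
    (hvacA : ∀ ν ∈ insert lam (Set.range mus), At ν Ωhat = α ν • Ωhat)
    (hvacD : ∀ ν ∈ insert lam (Set.range mus), Dt ν Ωhat = δ ν • Ωhat)
    (hBAE : ∀ k : Fin M,
      α (mus k) *
          ∏ l ∈ Finset.univ.erase k, (fa c (mus l - mus k) / fa c (mus k - mus l))
        = δ (mus k)) :
    (At lam + Dt lam) ((List.ofFn fun k => Bt (mus k)).prod Ωhat)
      = (α lam * ∏ k : Fin M, (1 / fa c (lam - mus k))
          + δ lam * ∏ k : Fin M, (1 / fa c (mus k - lam))) •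
        (List.ofFn fun k => Bt (mus k)).prod Ωhat := by
  set S : Set ℂ := insert lam (Set.range mus) with hS
  have hmus : ∀ k, mus k ∈ S := fun k => Or.inr ⟨k, rfl⟩
  have hlamS : lam ∈ S := Or.inl rfl
  have hshift : ∀ x ∈ S, ∀ y ∈ S, x ≠ y → x - y + Complex.I * c ≠ 0 := fun x hx y hy hxy h =>
    (hdiff x hx y hy hxy).2 (eq_neg_of_add_eq_zero_left h)
  have hf : ∀ x ∈ S, ∀ y ∈ S, x ≠ y → 1 / fa c (x - y) = 1 + Complex.I * c / (x - y) :=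
    fun x hx y hy hxy => one_div_fa (sub_ne_zero.2 hxy) (hshift x hx y hy hxy)
  have hf' : ∀ x ∈ S, ∀ y ∈ S, x ≠ y →
      1 / fa c (y - x) = 1 + -(Complex.I * c) / (x - y) := by
    intro x hx y hy hxy
    rw [hf y hy x hx hxy.symm, ← neg_sub x y, div_neg, neg_div]
  have hA : ∀ x ∈ S, ∀ y ∈ S, x ≠ y → At x * Bt y
      = (-(Complex.I * c / (x - y))) • (Bt x * At y)
        + (1 + Complex.I * c / (x - y)) • (Bt y * At x) := by
    intro x hx y hy hxy
    rw [hAB x hx y hy hxy, fb_div_fa (hshift x hx y hy hxy), hf x hx y hy hxy]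
  have hD : ∀ x ∈ S, ∀ y ∈ S, x ≠ y → Dt x * Bt y
      = (-(-(Complex.I * c) / (x - y))) • (Bt x * Dt y)
        + (1 + -(Complex.I * c) / (x - y)) • (Bt y * Dt x) := by
    intro x hx y hy hxy
    rw [hDB x hx y hy hxy, fb_div_fa (hshift y hy x hx hxy.symm), hf' x hx y hy hxy,
      ← neg_sub x y, div_neg, neg_div]
  set s : Finset ℂ := Finset.univ.map ⟨mus, hinj⟩ with hs
  have hsS : ↑s ⊆ S := by
    intro x hx
    obtain ⟨k, rfl⟩ : ∃ k, mus k = x := by simpa [hs] using hx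
    exact hmus k
  have hlams : lam ∉ s := by
    simpa [hs] using fun k => (hlam k).symm
  have hperm : s.toList.Perm (List.ofFn mus) := by
    rw [List.perm_ext_iff_of_nodup s.nodup_toList (List.nodup_ofFn.2 hinj)]
    intro x
    simp [hs, List.mem_ofFn]
  have hvec : (List.ofFn fun k => Bt (mus k)).prod Ωhat = betheVector Bt Ωhat s := by
    rw [betheVector_eq_of_perm hBB hsS hperm, List.map_ofFn]
    rfl
  have bethe : ∀ k ∈ s, α k * ∏ l ∈ s.erase k, (1 + Complex.I * c / (k - l))
      = δ k * ∏ l ∈ s.erase k, (1 + -(Complex.I * c) / (k - l)) := by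
    intro k hk
    obtain ⟨j, rfl⟩ : ∃ j, mus j = k := by simpa [hs] using hk
    have herase : s.erase (mus j) = (Finset.univ.erase j).map ⟨mus, hinj⟩ :=
      (Finset.map_erase ⟨mus, hinj⟩ Finset.univ j).symm
    rw [herase, Finset.prod_map, Finset.prod_map, ← hBAE j, mul_assoc, ← Finset.prod_mul_distrib]
    congr 1
    refine Finset.prod_congr rfl fun l hl => ?_
    have hjl : mus j ≠ mus l := fun h => (Finset.mem_erase.1 hl).1 (hinj h).symm
    have hne : fa c (mus l - mus j) ≠ 0 :=
      div_ne_zero (sub_ne_zero.2 hjl.symm) (hshift _ (hmus l) _ (hmus j) hjl.symm)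
    simp only [Function.Embedding.coeFn_mk]
    rw [← hf _ (hmus j) _ (hmus l) hjl, ← hf' _ (hmus j) _ (hmus l) hjl]
    field_simp
  have hprodA : ∏ k, (1 / fa c (lam - mus k)) = ∏ y ∈ s, (1 + Complex.I * c / (lam - y)) := by
    rw [hs, Finset.prod_map]
    exact Finset.prod_congr rfl fun k _ => hf _ hlamS _ (hmus k) (hlam k)
  have hprodD : ∏ k, (1 / fa c (mus k - lam)) = ∏ y ∈ s, (1 + -(Complex.I * c) / (lam - y)) := by
    rw [hs, Finset.prod_map]
    exact Finset.prod_congr rfl fun k _ => hf' _ hlamS _ (hmus k) (hlam k)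
  have cancel : ∑ k ∈ s, (-(Complex.I * c / (lam - k)) *
        (α k * ∏ l ∈ s.erase k, (1 + Complex.I * c / (k - l)))) •
          Bt lam (betheVector Bt Ωhat (s.erase k))
      + ∑ k ∈ s, (-(-(Complex.I * c) / (lam - k)) *
        (δ k * ∏ l ∈ s.erase k, (1 + -(Complex.I * c) / (k - l)))) •
          Bt lam (betheVector Bt Ωhat (s.erase k)) = 0 := by
    rw [← Finset.sum_add_distrib]
    refine Finset.sum_eq_zero fun k hk => ?_
    rw [bethe k hk, ← add_smul, neg_div, neg_neg, neg_mul, neg_add_cancel, zero_smul]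
  rw [hvec, LinearMap.add_apply, exchange_apply_betheVector hBB hA hvacA s hsS lam hlamS hlams,
    exchange_apply_betheVector hBB hD hvacD s hsS lam hlamS hlams, add_add_add_comm, cancel,
    add_zero, ← add_smul, hprodA, hprodD]

end Stmt13
end
end

section
/- Residue condition at λ_j reproduces the first Bethe ansatz equations: let λ₁,…,λ_N, μ₁,…,μ_M be pairwise distinct complex numbers with λ_k − λ_j ∉ {ic,−ic} for k ≠ j and λ_j − μ_k ∉ {ic,−ic} for all j,k, and let a₁, a₂, a₃ : ℂ → ℂ be continuous at λ_j. Then the function λ ↦ (λ − λ_j)Λ(λ) has a limit as λ → λ_j, and this limit equals 0 if and only if a₁(λ_j) ∏_{k=1}^M a(λ_j − μ_k) = a₂(λ_j), i.e. if and only if the Bethe ansatz equation a₁(λ_j)/a₂(λ_j) = ∏_{k=1}^M 1/a(λ_j − μ_k) holds. -/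
noncomputable section

namespace Stmt15

/-- `a(λ) = λ/(λ+ic)`. -/
def fa (c lam : ℂ) : ℂ := lam / (lam + Complex.I * c)

/-- The transfer-matrix eigenvalue of the gl(1|2) generalized model:
`Λ(λ) = a₁(λ) ∏_j 1/a(λ_j−λ) − a₂(λ) ∏_j 1/a(λ_j−λ) ∏_k 1/a(λ−μ_k)
        − a₃(λ) ∏_k 1/a(μ_k−λ)`. -/
def Lam (c : ℂ) {N M : ℕ} (lamj : Fin N → ℂ) (mus : Fin M → ℂ)
    (a1 a2 a3 : ℂ → ℂ) (lam : ℂ) : ℂ :=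
  a1 lam * ∏ m : Fin N, (1 / fa c (lamj m - lam))
    - a2 lam * (∏ m : Fin N, (1 / fa c (lamj m - lam))) *
        ∏ k : Fin M, (1 / fa c (lam - mus k))
    - a3 lam * ∏ k : Fin M, (1 / fa c (mus k - lam))

theorem one_div_fa (c x : ℂ) : 1 / fa c x = (x + Complex.I * c) / x := by
  rw [fa, one_div_div]

theorem fa_ne_zero {c x : ℂ} (hx : x ≠ 0) (hxc : x ≠ -(Complex.I * c)) : fa c x ≠ 0 :=
  div_ne_zero hx fun h => hxc (eq_neg_of_add_eq_zero_left h)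

theorem continuousAt_one_div_fa {c x : ℂ} (hx : x ≠ 0) :
    ContinuousAt (fun y => 1 / fa c y) x := by
  simp only [one_div_fa]
  exact (continuousAt_id.add continuousAt_const).div continuousAt_id hx

theorem sub_mul_one_div_fa {c x y : ℂ} (h : y ≠ x) :
    (y - x) * (1 / fa c (x - y)) = -(x - y + Complex.I * c) := by
  have h' : x - y ≠ 0 := sub_ne_zero.mpr h.symm
  rw [one_div_fa]
  field_simp
  ring

/-- The residue of `Λ` at `λ_j` vanishes if and only if the first Bethe ansatz
equation `a₁(λ_j) ∏_k a(λ_j−μ_k) = a₂(λ_j)` holds: the function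
`λ ↦ (λ−λ_j)Λ(λ)` has a limit as `λ → λ_j`, and this limit is `0` iff the
Bethe ansatz equation holds. -/
theorem residue_at_lamj_iff_first_BAE
    (c : ℂ) (hc : c ≠ 0) (N M : ℕ) (lamj : Fin N → ℂ) (mus : Fin M → ℂ)
    (a1 a2 a3 : ℂ → ℂ) (j : Fin N)
    (hinjl : Function.Injective lamj) (hinjm : Function.Injective mus)
    (hdisj : ∀ p q, lamj p ≠ mus q)
    (hll : ∀ k l : Fin N, k ≠ l →
      lamj k - lamj l ≠ Complex.I * c ∧ lamj k - lamj l ≠ -(Complex.I * c))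
    (hlm : ∀ p q,
      lamj p - mus q ≠ Complex.I * c ∧ lamj p - mus q ≠ -(Complex.I * c))
    (hc1 : ContinuousAt a1 (lamj j)) (hc2 : ContinuousAt a2 (lamj j))
    (hc3 : ContinuousAt a3 (lamj j)) :
    ∃ L : ℂ,
      Filter.Tendsto (fun lam => (lam - lamj j) * Lam c lamj mus a1 a2 a3 lam)
        (nhdsWithin (lamj j) {lamj j}ᶜ) (nhds L)
      ∧ (L = 0 ↔ a1 (lamj j) * ∏ k : Fin M, fa c (lamj j - mus k) = a2 (lamj j)) := by
  have hprod {n : ℕ} (s : Finset (Fin n)) (f : Fin n → ℂ → ℂ)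
      (hf : ∀ m ∈ s, ContinuousAt (f m) (lamj j)) (hf0 : ∀ m ∈ s, f m (lamj j) ≠ 0) :
      ContinuousAt (fun x => ∏ m ∈ s, 1 / fa c (f m x)) (lamj j) :=
    tendsto_finsetProd _ fun m hm =>
      ContinuousAt.comp (f := f m) (continuousAt_one_div_fa (hf0 m hm)) (hf m hm)
  have hP := hprod (Finset.univ.erase j) (fun m x => lamj m - x) (fun m _ => by fun_prop)
    fun m hm => sub_ne_zero.mpr (hinjl.ne (Finset.ne_of_mem_erase hm))
  have hQ := hprod Finset.univ (fun k x => x - mus k) (fun k _ => by fun_prop)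
    fun k _ => sub_ne_zero.mpr (hdisj j k)
  have hR := hprod Finset.univ (fun k x => mus k - x) (fun k _ => by fun_prop)
    fun k _ => sub_ne_zero.mpr (hdisj j k).symm
  have hlin : ContinuousAt (fun x => -(lamj j - x + Complex.I * c)) (lamj j) := by fun_prop
  have hsub : ContinuousAt (fun x => x - lamj j) (lamj j) := by fun_prop
  have hG := ((hlin.mul hP).mul (hc1.sub (hc2.mul hQ))).sub (hsub.mul (hc3.mul hR))
  refine ⟨_, (hG.tendsto.mono_left nhdsWithin_le_nhds).congr' ?_, ?_⟩
  · filter_upwards [self_mem_nhdsWithin] with x hx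
    have hx' := sub_mul_one_div_fa (c := c) (show x ≠ lamj j from hx)
    simp only [Lam, Pi.mul_apply, Pi.sub_apply]
    rw [← Finset.mul_prod_erase Finset.univ (fun m => 1 / fa c (lamj m - x))
      (Finset.mem_univ j), ← hx']
    ring
  · have hP0 : ∏ m ∈ Finset.univ.erase j, 1 / fa c (lamj m - lamj j) ≠ 0 :=
      Finset.prod_ne_zero_iff.mpr fun m hm =>
        have hmj := Finset.ne_of_mem_erase hm
        one_div_ne_zero (fa_ne_zero (sub_ne_zero.mpr (hinjl.ne hmj)) (hll m j hmj).2)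
    have hQ0 : ∏ k, fa c (lamj j - mus k) ≠ 0 :=
      Finset.prod_ne_zero_iff.mpr fun k _ =>
        fa_ne_zero (sub_ne_zero.mpr (hdisj j k)) (hlm j k).2
    have hic : -(Complex.I * c) ≠ 0 := neg_ne_zero.mpr (mul_ne_zero Complex.I_ne_zero hc)
    simp only [Pi.mul_apply, Pi.sub_apply, sub_self, zero_mul, sub_zero, zero_add]
    rw [mul_eq_zero, or_iff_right (mul_ne_zero hic hP0), sub_eq_zero]
    simp only [one_div, Finset.prod_inv_distrib]
    exact eq_mul_inv_iff_mul_eq₀ hQ0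

end Stmt15
end
end

section
/- Residue condition at μ_k reproduces the second Bethe ansatz equations: let λ₁,…,λ_N, μ₁,…,μ_M be pairwise distinct complex numbers with λ_j − μ_k ∉ {ic,−ic} for all j,k and μ_l − μ_k ∉ {ic,−ic} for l ≠ k, and let a₁, a₂, a₃ : ℂ → ℂ be continuous at μ_k. Then the function λ ↦ (λ − μ_k)Λ(λ) has a limit as λ → μ_k, and this limit equals 0 if and only if a₂(μ_k) ∏_{l≠k} a(μ_l − μ_k) = a₃(μ_k) ∏_{j=1}^N a(λ_j − μ_k) ∏_{l≠k} a(μ_k − μ_l), i.e. if and only if the Bethe ansatz equation (a₂(μ_k)/a₃(μ_k)) ∏_{j=1}^N 1/a(λ_j − μ_k) = ∏_{l≠k} a(μ_k − μ_l)/a(μ_l − μ_k) holds. -/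
noncomputable section

namespace Stmt16

/-- `a(λ) = λ/(λ+ic)`. -/
def fa (c lam : ℂ) : ℂ := lam / (lam + Complex.I * c)

/-- The transfer-matrix eigenvalue of the gl(1|2) generalized model:
`Λ(λ) = a₁(λ) ∏_j 1/a(λ_j−λ) − a₂(λ) ∏_j 1/a(λ_j−λ) ∏_k 1/a(λ−μ_k)
        − a₃(λ) ∏_k 1/a(μ_k−λ)`. -/
def Lam (c : ℂ) {N M : ℕ} (lamj : Fin N → ℂ) (mus : Fin M → ℂ)
    (a1 a2 a3 : ℂ → ℂ) (lam : ℂ) : ℂ :=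
  a1 lam * ∏ m : Fin N, (1 / fa c (lamj m - lam))
    - a2 lam * (∏ m : Fin N, (1 / fa c (lamj m - lam))) *
        ∏ k : Fin M, (1 / fa c (lam - mus k))
    - a3 lam * ∏ k : Fin M, (1 / fa c (mus k - lam))

lemma fa_ne_zero {c x : ℂ} (hx : x ≠ 0) (hx' : x ≠ -(Complex.I * c)) : fa c x ≠ 0 :=
  div_ne_zero hx fun h => hx' (eq_neg_of_add_eq_zero_left h)

lemma one_div_fa (c x : ℂ) : 1 / fa c x = (x + Complex.I * c) / x :=
  one_div_div _ _

lemma continuousAt_one_div_fa {c : ℂ} {f : ℂ → ℂ} {x : ℂ} (hf : ContinuousAt f x)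
    (hx : f x ≠ 0) : ContinuousAt (fun z => 1 / fa c (f z)) x := by
  simp only [one_div_fa]
  exact (hf.add continuousAt_const).div hf hx

lemma continuousAt_prod_one_div_fa {c : ℂ} {ι : Type*} {s : Finset ι} {f : ι → ℂ → ℂ} {x : ℂ}
    (hf : ∀ i ∈ s, ContinuousAt (f i) x) (hx : ∀ i ∈ s, f i x ≠ 0) :
    ContinuousAt (fun z => ∏ i ∈ s, (1 / fa c (f i z))) x :=
  tendsto_finsetProd s fun i hi => continuousAt_one_div_fa (hf i hi) (hx i hi)

/-- Away from the pole at `μ_k`, `(λ - μ_k) Λ(λ)` with the vanishing denominators cancelled. -/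
lemma sub_mul_Lam (c : ℂ) {N M : ℕ} (lamj : Fin N → ℂ) (mus : Fin M → ℂ)
    (a1 a2 a3 : ℂ → ℂ) (k : Fin M) {z : ℂ} (hz : z ≠ mus k) :
    (z - mus k) * Lam c lamj mus a1 a2 a3 z =
      (z - mus k) * (a1 z * ∏ m : Fin N, (1 / fa c (lamj m - z)))
        - a2 z * (∏ m : Fin N, (1 / fa c (lamj m - z))) *
          ((z - mus k + Complex.I * c) * ∏ l ∈ Finset.univ.erase k, (1 / fa c (z - mus l)))
        + a3 z * ((mus k - z + Complex.I * c) *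
          ∏ l ∈ Finset.univ.erase k, (1 / fa c (mus l - z))) := by
  have h₁ : z - mus k ≠ 0 := sub_ne_zero.mpr hz
  have h₂ : mus k - z ≠ 0 := sub_ne_zero.mpr hz.symm
  have e₁ : (z - mus k) * (1 / fa c (z - mus k)) = z - mus k + Complex.I * c := by
    rw [one_div_fa, mul_div_cancel₀ _ h₁]
  have e₂ : (z - mus k) * (1 / fa c (mus k - z)) = -(mus k - z + Complex.I * c) := by
    rw [one_div_fa, ← neg_sub (mus k) z, neg_mul, mul_div_cancel₀ _ h₂]
  rw [Lam, ← Finset.mul_prod_erase _ (fun l => 1 / fa c (z - mus l)) (Finset.mem_univ k),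
    ← Finset.mul_prod_erase _ (fun l => 1 / fa c (mus l - z)) (Finset.mem_univ k)]
  linear_combination
    (-(a2 z * (∏ m : Fin N, (1 / fa c (lamj m - z))) *
      ∏ l ∈ Finset.univ.erase k, (1 / fa c (z - mus l)))) * e₁
    - (a3 z * ∏ l ∈ Finset.univ.erase k, (1 / fa c (mus l - z))) * e₂

/-- The residue of `Λ` at `μ_k` vanishes if and only if the second Bethe ansatz
equation `a₂(μ_k) ∏_{l≠k} a(μ_l−μ_k) = a₃(μ_k) ∏_j a(λ_j−μ_k) ∏_{l≠k} a(μ_k−μ_l)`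
holds: the function `λ ↦ (λ−μ_k)Λ(λ)` has a limit as `λ → μ_k`, and this limit
is `0` iff the Bethe ansatz equation holds. -/
theorem residue_at_muk_iff_second_BAE
    (c : ℂ) (hc : c ≠ 0) (N M : ℕ) (lamj : Fin N → ℂ) (mus : Fin M → ℂ)
    (a1 a2 a3 : ℂ → ℂ) (k : Fin M)
    (hinjl : Function.Injective lamj) (hinjm : Function.Injective mus)
    (hdisj : ∀ p q, lamj p ≠ mus q)
    (hlm : ∀ p q,
      lamj p - mus q ≠ Complex.I * c ∧ lamj p - mus q ≠ -(Complex.I * c))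
    (hmm : ∀ l r : Fin M, l ≠ r →
      mus l - mus r ≠ Complex.I * c ∧ mus l - mus r ≠ -(Complex.I * c))
    (hc1 : ContinuousAt a1 (mus k)) (hc2 : ContinuousAt a2 (mus k))
    (hc3 : ContinuousAt a3 (mus k)) :
    ∃ L : ℂ,
      Filter.Tendsto (fun lam => (lam - mus k) * Lam c lamj mus a1 a2 a3 lam)
        (nhdsWithin (mus k) {mus k}ᶜ) (nhds L)
      ∧ (L = 0 ↔
          a2 (mus k) * ∏ l ∈ Finset.univ.erase k, fa c (mus l - mus k)
            = a3 (mus k) * (∏ j : Fin N, fa c (lamj j - mus k)) *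
                ∏ l ∈ Finset.univ.erase k, fa c (mus k - mus l)) := by
  have hne : ∀ l ∈ Finset.univ.erase k, mus l - mus k ≠ 0 := fun l hl =>
    sub_ne_zero.mpr (hinjm.ne (Finset.ne_of_mem_erase hl))
  have hne' : ∀ l ∈ Finset.univ.erase k, mus k - mus l ≠ 0 := fun l hl =>
    sub_ne_zero.mpr (hinjm.ne (Finset.ne_of_mem_erase hl).symm)
  have hF : ContinuousAt (fun z => ∏ m : Fin N, (1 / fa c (lamj m - z))) (mus k) :=
    continuousAt_prod_one_div_fa (fun _ _ => by fun_prop)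
      fun m _ => sub_ne_zero.mpr (hdisj m k)
  have hA : ContinuousAt
      (fun z => ∏ l ∈ Finset.univ.erase k, (1 / fa c (z - mus l))) (mus k) :=
    continuousAt_prod_one_div_fa (f := fun l z => z - mus l) (fun _ _ => by fun_prop) hne'
  have hB : ContinuousAt
      (fun z => ∏ l ∈ Finset.univ.erase k, (1 / fa c (mus l - z))) (mus k) :=
    continuousAt_prod_one_div_fa (fun _ _ => by fun_prop) hne
  have hsub : ContinuousAt (fun z => z - mus k) (mus k) := by fun_prop
  have hadd : ContinuousAt (fun z => z - mus k + Complex.I * c) (mus k) := by fun_prop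
  have hadd' : ContinuousAt (fun z => mus k - z + Complex.I * c) (mus k) := by fun_prop
  have hlim := (((hsub.mul (hc1.mul hF)).sub ((hc2.mul hF).mul (hadd.mul hA))).add
    (hc3.mul (hadd'.mul hB))).tendsto.mono_left (nhdsWithin_le_nhds (s := {mus k}ᶜ))
  refine ⟨_, hlim.congr' ?_, ?_⟩
  · filter_upwards [self_mem_nhdsWithin] with z hz
    exact (sub_mul_Lam c lamj mus a1 a2 a3 k hz).symm
  · have hF0 : ∏ j : Fin N, fa c (lamj j - mus k) ≠ 0 := Finset.prod_ne_zero_iff.mpr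
      fun j _ => fa_ne_zero (sub_ne_zero.mpr (hdisj j k)) (hlm j k).2
    have hA0 : ∏ l ∈ Finset.univ.erase k, fa c (mus k - mus l) ≠ 0 :=
      Finset.prod_ne_zero_iff.mpr fun l hl =>
        fa_ne_zero (hne' l hl) (hmm k l (Finset.ne_of_mem_erase hl).symm).2
    have hB0 : ∏ l ∈ Finset.univ.erase k, fa c (mus l - mus k) ≠ 0 :=
      Finset.prod_ne_zero_iff.mpr fun l hl =>
        fa_ne_zero (hne l hl) (hmm l k (Finset.ne_of_mem_erase hl)).2
    have hIc : Complex.I * c ≠ 0 := mul_ne_zero Complex.I_ne_zero hc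
    simp only [Pi.mul_apply, Pi.add_apply, Pi.sub_apply, one_div, Finset.prod_inv_distrib,
      sub_self, zero_mul, zero_add, zero_sub]
    generalize (∏ j : Fin N, fa c (lamj j - mus k)) = F at *
    generalize (∏ l ∈ Finset.univ.erase k, fa c (mus k - mus l)) = A at *
    generalize (∏ l ∈ Finset.univ.erase k, fa c (mus l - mus k)) = B at *
    have key : -(a2 (mus k) * F⁻¹ * (Complex.I * c * A⁻¹)) + a3 (mus k) * (Complex.I * c * B⁻¹)
        = Complex.I * c / (F * A * B) * (a3 (mus k) * F * A - a2 (mus k) * B) := by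
      field_simp
      ring
    rw [key, mul_eq_zero_iff_left (div_ne_zero hIc (mul_ne_zero (mul_ne_zero hF0 hA0) hB0)),
      sub_eq_zero, eq_comm]

end Stmt16
end
end

section
/- The Bethe ansatz equations of the gl(1|2) generalized model become the Lieb–Wu equations: let c ≠ 0, L ∈ ℕ, and let k₁,…,k_N, v₁,…,v_M ∈ ℂ; set λ_j = sin k_j and μ_k = v_k + ic/2, and assume λ_j ≠ μ_k, λ_j − μ_k ≠ −ic for all j,k, the μ_k pairwise distinct with μ_k − μ_l ∉ {ic,−ic} for k ≠ l. Suppose the functions a₁, a₂, a₃ satisfy a₁(sin k_j) = e^{i k_j L} a₂(sin k_j) with a₂(sin k_j) ≠ 0, and a₂(v_k + ic/2) = a₃(v_k + ic/2) ≠ 0. Then: (i) the first Bethe ansatz equation a₁(λ_j)/a₂(λ_j) = ∏_{k=1}^M 1/a(λ_j − μ_k) holds if and only if e^{i k_j L} = ∏_{k=1}^M (v_k − sin k_j − ic/2)/(v_k − sin k_j + ic/2); and (ii) the second Bethe ansatz equation (a₂(μ_k)/a₃(μ_k)) ∏_{j=1}^N 1/a(λ_j − μ_k) = ∏_{l≠k}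 a(μ_k − μ_l)/a(μ_l − μ_k) holds if and only if ∏_{j=1}^N (v_k − sin k_j − ic/2)/(v_k − sin k_j + ic/2) = ∏_{l≠k} (v_k − v_l − ic)/(v_k − v_l + ic). These are the Lieb–Wu equations of the Hubbard model, with c corresponding to U/2. -/
noncomputable section

namespace Stmt17

/-- `a(λ) = λ/(λ+ic)`. -/
def fa (c lam : ℂ) : ℂ := lam / (lam + Complex.I * c)

lemma one_div_fa (c s w : ℂ) :
    1 / fa c (s - (w + Complex.I * c / 2))
      = (w - s - Complex.I * c / 2) / (w - s + Complex.I * c / 2) := by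
  rw [fa, one_div_div, ← neg_div_neg_eq]
  congr 1 <;> ring

lemma fa_div_fa_neg (c : ℂ) {x : ℂ} (hx : x ≠ 0) :
    fa c x / fa c (-x) = (x - Complex.I * c) / (x + Complex.I * c) := by
  rw [fa, fa, div_div_div_comm, div_neg, div_self hx, div_div_eq_mul_div]
  congr 1
  ring

/-- For the choice `λ_j = sin k_j`, `μ_k = v_k + ic/2` of spectral parameters and
parameters `a₁, a₂, a₃` satisfying `a₁(sin k_j) = e^{i k_j L} a₂(sin k_j)` and
`a₂(v_k + ic/2) = a₃(v_k + ic/2)`, the Bethe ansatz equations of the gl(1|2)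
generalized model are equivalent to the Lieb–Wu equations of the Hubbard model
(with `c` corresponding to `U/2`). -/
theorem bethe_ansatz_equations_iff_lieb_wu
    (c : ℂ) (hc : c ≠ 0) (L : ℕ) (N M : ℕ) (k : Fin N → ℂ) (v : Fin M → ℂ)
    (a1 a2 a3 : ℂ → ℂ)
    (hne : ∀ j q, Complex.sin (k j) ≠ v q + Complex.I * c / 2)
    (hic : ∀ j q,
      Complex.sin (k j) - (v q + Complex.I * c / 2) ≠ -(Complex.I * c))
    (hinjm : Function.Injective fun q => v q + Complex.I * c / 2)
    (hmm : ∀ q r : Fin M, q ≠ r →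
      (v q + Complex.I * c / 2) - (v r + Complex.I * c / 2) ≠ Complex.I * c ∧
      (v q + Complex.I * c / 2) - (v r + Complex.I * c / 2) ≠ -(Complex.I * c))
    (h1 : ∀ j, a1 (Complex.sin (k j))
      = Complex.exp (Complex.I * k j * (L : ℂ)) * a2 (Complex.sin (k j)))
    (h2 : ∀ j, a2 (Complex.sin (k j)) ≠ 0)
    (h3 : ∀ q, a2 (v q + Complex.I * c / 2) = a3 (v q + Complex.I * c / 2))
    (h4 : ∀ q, a3 (v q + Complex.I * c / 2) ≠ 0) :
    (∀ j : Fin N,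
      (a1 (Complex.sin (k j)) / a2 (Complex.sin (k j))
          = ∏ q : Fin M, (1 / fa c (Complex.sin (k j) - (v q + Complex.I * c / 2))))
        ↔ Complex.exp (Complex.I * k j * (L : ℂ))
            = ∏ q : Fin M, ((v q - Complex.sin (k j) - Complex.I * c / 2) /
                (v q - Complex.sin (k j) + Complex.I * c / 2)))
    ∧ (∀ q : Fin M,
      ((a2 (v q + Complex.I * c / 2) / a3 (v q + Complex.I * c / 2)) *
            ∏ j : Fin N, (1 / fa c (Complex.sin (k j) - (v q + Complex.I * c / 2)))
          = ∏ r ∈ Finset.univ.erase q,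
              (fa c ((v q + Complex.I * c / 2) - (v r + Complex.I * c / 2)) /
               fa c ((v r + Complex.I * c / 2) - (v q + Complex.I * c / 2))))
        ↔ (∏ j : Fin N, ((v q - Complex.sin (k j) - Complex.I * c / 2) /
              (v q - Complex.sin (k j) + Complex.I * c / 2))
            = ∏ r ∈ Finset.univ.erase q,
                ((v q - v r - Complex.I * c) / (v q - v r + Complex.I * c)))) := by
  refine ⟨fun j => ?_, fun q => ?_⟩
  · rw [h1 j, mul_div_cancel_right₀ _ (h2 j)]
    simp only [one_div_fa]
  · have hprod : ∏ r ∈ Finset.univ.erase q,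
        (fa c ((v q + Complex.I * c / 2) - (v r + Complex.I * c / 2)) /
          fa c ((v r + Complex.I * c / 2) - (v q + Complex.I * c / 2)))
        = ∏ r ∈ Finset.univ.erase q,
            ((v q - v r - Complex.I * c) / (v q - v r + Complex.I * c)) := by
      refine Finset.prod_congr rfl fun r hr => ?_
      have hqr : v q - v r ≠ 0 := fun h =>
        Finset.ne_of_mem_erase hr (hinjm (by simp [sub_eq_zero.mp h]))
      rw [add_sub_add_right_eq_sub, add_sub_add_right_eq_sub, ← neg_sub (v q) (v r),
        fa_div_fa_neg c hqr]
    rw [h3 q, div_self (h4 q), one_mul, hprod]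
    simp only [one_div_fa]


end Stmt17
end
end

section
/- Rational identity (B.3): let λ, λ₁, …, λ_{N+1} be pairwise distinct complex numbers with all pairwise differences not equal to −ic. Then (b(λ − λ_{N+1})/a(λ − λ_{N+1})) ∏_{k=1}^N 1/a(λ_{N+1} − λ_k) = (b(λ − λ_{N+1})/a(λ − λ_{N+1})) ∏_{j=1}^N 1/a(λ − λ_j) − Σ_{j=1}^N (b(λ_j − λ_{N+1})/a(λ_j − λ_{N+1})) (b(λ − λ_j)/a(λ − λ_j)) ∏_{k=1, k≠j}^N 1/a(λ_j − λ_k). -/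
noncomputable section

namespace Stmt18

/-- `a(λ) = λ/(λ+ic)`. -/
def fa (c lam : ℂ) : ℂ := lam / (lam + Complex.I * c)

/-- `b(λ) = ic/(λ+ic)`. -/
def fb (c lam : ℂ) : ℂ := Complex.I * c / (lam + Complex.I * c)

open Finset in
theorem sum_div_sub_sub_sum_div_sub {F ι : Type*} [Field F] (s : Finset ι) (v w : ι → F)
    {x y : F} (hx : ∀ i ∈ s, x ≠ v i) (hy : ∀ i ∈ s, y ≠ v i) :
    ∑ i ∈ s, w i / (x - v i) - ∑ i ∈ s, w i / (y - v i)
      = (x - y) * ∑ i ∈ s, w i / ((x - v i) * (v i - y)) := by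
  rw [← sum_sub_distrib, mul_sum]
  refine sum_congr rfl fun i hi => ?_
  have h₁ := sub_ne_zero.mpr (hx i hi)
  have h₂ := sub_ne_zero.mpr (hy i hi)
  have h₃ := sub_ne_zero.mpr (hy i hi).symm
  rw [← neg_sub y (v i)]
  field_simp
  ring

open Finset in
/-- Partial fraction expansion of `∏ (x - vᵢ + e) / (x - vᵢ)` at its simple poles `vᵢ`. -/
theorem prod_sub_add_div_sub_eq_one_add_sum {F ι : Type*} [Field F] [DecidableEq ι]
    (e : F) (v : ι → F) (s : Finset ι) (hv : Set.InjOn v s) {x : F} (hx : ∀ i ∈ s, x ≠ v i) :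
    ∏ i ∈ s, (x - v i + e) / (x - v i)
      = 1 + ∑ i ∈ s, e * (∏ k ∈ s.erase i, (v i - v k + e) / (v i - v k)) / (x - v i) := by
  induction s using Finset.induction_on generalizing x with
  | empty => simp
  | insert a s ha ih =>
    have hvs : Set.InjOn v s := hv.mono (by simp)
    have hxs : ∀ i ∈ s, x ≠ v i := fun i hi => hx i (mem_insert_of_mem hi)
    have has : ∀ i ∈ s, v a ≠ v i := fun i hi h =>
      ha (hv (by simp) (by simp [hi]) h ▸ hi)
    have hxa : x - v a ≠ 0 := sub_ne_zero.mpr (hx a (mem_insert_self a s))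
    set R : ι → F := fun i => e * ∏ k ∈ s.erase i, (v i - v k + e) / (v i - v k) with hR
    have hdiff := sum_div_sub_sub_sum_div_sub s v R hxs has
    have hsum : ∑ i ∈ s, e * (∏ k ∈ (insert a s).erase i, (v i - v k + e) / (v i - v k)) /
          (x - v i)
        = ∑ i ∈ s, R i / (x - v i) + e * ∑ i ∈ s, R i / ((x - v i) * (v i - v a)) := by
      rw [mul_sum, ← sum_add_distrib]
      refine sum_congr rfl fun i hi => ?_
      have hia : a ≠ i := fun h => ha (h ▸ hi)
      have h₁ := sub_ne_zero.mpr (hxs i hi)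
      have h₂ := sub_ne_zero.mpr (has i hi).symm
      rw [erase_insert_of_ne hia, prod_insert (fun h => ha (mem_of_mem_erase h)), hR]
      field_simp
    rw [prod_insert ha, sum_insert ha, erase_insert ha, hsum, ih hvs hxs, ih hvs has]
    field_simp
    linear_combination e * hdiff

/-- Rational identity (B.3) of the paper; here `nu` plays the role of
`λ_{N+1}`:
`(b/a)(λ−λ_{N+1}) ∏_{k=1}^N 1/a(λ_{N+1}−λ_k)
  = (b/a)(λ−λ_{N+1}) ∏_{j=1}^N 1/a(λ−λ_j)
    − Σ_{j=1}^N (b/a)(λ_j−λ_{N+1}) (b/a)(λ−λ_j) ∏_{k≠j} 1/a(λ_j−λ_k)`. -/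
theorem rational_identity_B3
    (c : ℂ) (hc : c ≠ 0) (N : ℕ) (lam nu : ℂ) (lamj : Fin N → ℂ)
    (hinj : Function.Injective lamj)
    (hlam : ∀ m, lam ≠ lamj m) (hnu : ∀ m, nu ≠ lamj m) (hln : lam ≠ nu)
    (hdiff : ∀ x ∈ insert lam (insert nu (Set.range lamj)),
      ∀ y ∈ insert lam (insert nu (Set.range lamj)),
        x ≠ y → x - y ≠ -(Complex.I * c)) :
    fb c (lam - nu) / fa c (lam - nu) * ∏ m : Fin N, (1 / fa c (nu - lamj m))
      = fb c (lam - nu) / fa c (lam - nu) * ∏ m : Fin N, (1 / fa c (lam - lamj m))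
        - ∑ j : Fin N,
            (fb c (lamj j - nu) / fa c (lamj j - nu)) *
              (fb c (lam - lamj j) / fa c (lam - lamj j)) *
              ∏ m ∈ Finset.univ.erase j, (1 / fa c (lamj j - lamj m)) := by
  have hb : ∀ {x : ℂ}, x + Complex.I * c ≠ 0 → fb c x / fa c x = Complex.I * c / x :=
    fun h => div_div_div_cancel_right₀ h _ _
  have hne : ∀ x ∈ insert lam (insert nu (Set.range lamj)),
      ∀ y ∈ insert lam (insert nu (Set.range lamj)),
        x ≠ y → x - y + Complex.I * c ≠ 0 :=
    fun x hx y hy hxy h => hdiff x hx y hy hxy (eq_neg_of_add_eq_zero_left h)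
  have hinjOn : Set.InjOn lamj (Finset.univ : Finset (Fin N)) := hinj.injOn
  have hx : ∀ i ∈ Finset.univ, lam ≠ lamj i := fun i _ => hlam i
  have hy : ∀ i ∈ Finset.univ, nu ≠ lamj i := fun i _ => hnu i
  have hdiv : lam - nu ≠ 0 := sub_ne_zero.mpr hln
  have hsum : ∀ j, (fb c (lamj j - nu) / fa c (lamj j - nu)) *
        (fb c (lam - lamj j) / fa c (lam - lamj j)) *
        ∏ m ∈ Finset.univ.erase j, (1 / fa c (lamj j - lamj m))
      = Complex.I * c * (Complex.I * c * (∏ m ∈ Finset.univ.erase j,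
        (lamj j - lamj m + Complex.I * c) / (lamj j - lamj m)) /
          ((lam - lamj j) * (lamj j - nu))) := fun j => by
    rw [hb (hne _ (by simp) _ (by simp) (hnu j).symm), hb (hne _ (by simp) _ (by simp) (hlam j))]
    simp only [fa, one_div_div]
    have h₁ := sub_ne_zero.mpr (hlam j)
    have h₂ := sub_ne_zero.mpr (hnu j).symm
    field_simp
  rw [Finset.sum_congr rfl fun j _ => hsum j, ← Finset.mul_sum,
    hb (hne _ (by simp) _ (by simp) hln)]
  simp only [fa, one_div_div]
  rw [prod_sub_add_div_sub_eq_one_add_sum _ lamj _ hinjOn hx,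
    prod_sub_add_div_sub_eq_one_add_sum _ lamj _ hinjOn hy]
  have h := sum_div_sub_sub_sum_div_sub Finset.univ lamj (fun j => Complex.I * c *
    ∏ m ∈ Finset.univ.erase j, (lamj j - lamj m + Complex.I * c) / (lamj j - lamj m)) hx hy
  field_simp
  linear_combination -h

end Stmt18
end
end
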